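/- arXiv:2312.00322 — 2 statements merged into one kernel-verified Lean document; each statement's English description precedes it below -/
import Mathlib

section
/- Let A be a finite abelian group equipped with an additive involution x ↦ x̄. Then the largest odd divisor of the cardinality of the subgroup {x ∈ A : x̄ = −x} divides the order of the subgroup {x − x̄ : x ∈ A}. (Proof idea from the paper: if x̄ = −x then x − x̄ = 2x, so 2·{x : x̄ = −x} is contained in {x − x̄ : x ∈ A}, and the odd part of a finite abelian group is unchanged by multiplication by 2.) -/
/-- For a finite abelian group `A` with an additive involution `ι`,
the largest odd divisor of `|{x ∈ A : ι x = -x}|` divides `|{x - ι x : x ∈ A}|`. -/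
theorem stmt_2 {A : Type*} [AddCommGroup A] [Fintype A]
    (ι : A →+ A) (hι : ∀ a, ι (ι a) = a) :
    ordCompl[2] (Nat.card {x : A // ι x = -x}) ∣
      Nat.card {y : A // ∃ x : A, y = x - ι x} := by
  let E : AddSubgroup A := (ι + AddMonoidHom.id A).ker
  let I : AddSubgroup A := (AddMonoidHom.id A - ι).range
  have memE : ∀ x, x ∈ E ↔ ι x = -x := fun x => by
    simp [E, AddMonoidHom.mem_ker, eq_neg_iff_add_eq_zero]
  have memI : ∀ y, y ∈ I ↔ ∃ x, y = x - ι x := fun y => by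
    simp [I, AddMonoidHom.mem_range, eq_comm]
  have hE : Nat.card {x : A // ι x = -x} = Nat.card E :=
    Nat.card_congr (Equiv.subtypeEquivRight fun x => (memE x).symm)
  have hI : Nat.card {y : A // ∃ x : A, y = x - ι x} = Nat.card I :=
    Nat.card_congr (Equiv.subtypeEquivRight fun x => (memI x).symm)
  rw [hE, hI]
  have hle : I ≤ E := by
    intro y hy
    obtain ⟨x, rfl⟩ := (memI y).1 hy
    rw [memE, map_sub, hι]; abel
  let J : AddSubgroup E := I.addSubgroupOf E
  have hJ : Nat.card J = Nat.card I :=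
    Nat.card_congr (AddSubgroup.addSubgroupOfEquivOfLe hle).toEquiv
  have hp : IsPGroup 2 (Multiplicative (E ⧸ J)) := by
    intro g
    refine ⟨1, ?_⟩
    obtain ⟨q, rfl⟩ := Multiplicative.ofAdd.surjective g
    obtain ⟨x, rfl⟩ := QuotientAddGroup.mk_surjective q
    rw [← ofAdd_nsmul, ofAdd_eq_one, ← QuotientAddGroup.mk_nsmul,
      QuotientAddGroup.eq_zero_iff, AddSubgroup.mem_addSubgroupOf, memI]
    refine ⟨x, ?_⟩
    rw [(memE _).1 x.2]
    simp [two_nsmul]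
  obtain ⟨k, hk⟩ := IsPGroup.iff_card.1 hp
  have hk' : Nat.card (E ⧸ J) = 2 ^ k := hk
  have hmul := AddSubgroup.card_eq_card_quotient_mul_card_addSubgroup J
  rw [hk', hJ] at hmul
  have hcop : Nat.Coprime (ordCompl[2] (Nat.card E)) (2 ^ k) :=
    ((Nat.coprime_ordCompl Nat.prime_two Nat.card_pos.ne').pow_left k).symm
  refine hcop.dvd_of_dvd_mul_left ?_
  rw [← hmul]
  exact Nat.ordCompl_dvd _ _
end

section
/- Let m ≥ 2 be a squarefree integer. Then the subgroup {x ∈ Cl_d : x̄ = x⁻¹} is trivial for every divisor d ≥ 2 of m if and only if h_m⁻ = 1 (equivalently: the product over all divisors d of m of |{x ∈ Cl_d : x̄ = x⁻¹}| equals 1 if and only if h_m⁻ = 1). -/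
open NumberField
open scoped nonZeroDivisors


section Weight
open NumberField.Units NumberField.Units.dirichletUnitTheorem NumberField.mixedEmbedding Module

noncomputable def tent (t : ℝ) : ℝ := max 0 (1 - |t|)

lemma tent_nonneg (t : ℝ) : 0 ≤ tent t := le_max_left _ _
lemma tent_le_one (t : ℝ) : tent t ≤ 1 := by
  unfold tent; exact max_le zero_le_one (by linarith [abs_nonneg t])
lemma tent_ne_zero {t : ℝ} (h : tent t ≠ 0) : |t| ≤ 1 := by
  by_contra hc
  push Not at hc
  exact h (by unfold tent; exact max_eq_left (by linarith))
lemma tent_lip (s t : ℝ) : |tent s - tent t| ≤ |s - t| := by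
  unfold tent
  refine (abs_max_sub_max_le_max _ _ _ _).trans ?_
  simp only [sub_self, abs_zero]
  refine max_le (abs_nonneg _) ?_
  rw [show (1 - |s| - (1 - |t|)) = |t| - |s| by ring, abs_sub_comm s t]
  exact abs_abs_sub_abs_le_abs_sub t s

lemma tent_sum (t : ℝ) : ∃ A : Finset ℤ, (∀ k ∉ A, tent (t + k) = 0) ∧
    ∑ k ∈ A, tent (t + k) = 1 := by
  refine ⟨{-⌊t⌋, -⌊t⌋ - 1}, ?_, ?_⟩
  · intro k hk
    simp only [Finset.mem_insert, Finset.mem_singleton, not_or] at hk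
    by_contra h
    have := abs_le.mp (tent_ne_zero h)
    have h1 := Int.floor_le t
    have h2 := Int.lt_floor_add_one t
    have h5 : t + k ≠ -1 ∧ t + k ≠ 1 := by
      constructor <;> intro h6 <;> apply h <;> rw [h6] <;> simp [tent]
    have h7 : -1 < t + k := lt_of_le_of_ne this.1 (Ne.symm h5.1)
    have h8 : t + k < 1 := lt_of_le_of_ne this.2 h5.2
    have h3 : ((-⌊t⌋ - 2 : ℤ) : ℝ) < k := by push_cast; linarith
    have h4 : (k : ℝ) < ((-⌊t⌋ + 1 : ℤ) : ℝ) := by push_cast; linarith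
    have h3 := Int.cast_lt.mp h3
    have h4 := Int.cast_lt.mp h4
    omega
  · rw [Finset.sum_pair (by omega)]
    have h1 := Int.floor_le t
    have h2 := Int.lt_floor_add_one t
    push_cast
    unfold tent
    rw [abs_of_nonneg (show 0 ≤ t + -(⌊t⌋ : ℝ) by linarith),
      abs_of_nonpos (show t + (-(⌊t⌋ : ℝ) - 1) ≤ 0 by linarith), max_eq_right (by linarith),
      max_eq_right (by linarith)]
    ring

variable (K : Type*) [Field K] [NumberField K]

open scoped Classical in
noncomputable def ybasis : Basis (Fin (rank K)) ℝ (logSpace K) :=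
  (basisUnitLattice K).ofZLatticeBasis ℝ (unitLattice K)

variable {K}

noncomputable def wt (a : 𝓞 K) : ℝ :=
  ∏ i, tent ((ybasis K).repr (logMap (mixedEmbedding K (a : K))) i)

lemma wt_nonneg (a : 𝓞 K) : 0 ≤ wt a := Finset.prod_nonneg fun _ _ => tent_nonneg _
lemma wt_le_one (a : 𝓞 K) : wt a ≤ 1 :=
  Finset.prod_le_one (fun _ _ => tent_nonneg _) fun _ _ => tent_le_one _

lemma norm_emb_ne_zero {a : 𝓞 K} (ha : a ≠ 0) :
    mixedEmbedding.norm (mixedEmbedding K (a : K)) ≠ 0 := by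
  rw [mixedEmbedding.norm_eq_norm]
  simpa using ha

lemma wt_unit {a : 𝓞 K} (ha : a ≠ 0) (ζ : torsion K) (k : Fin (rank K) → ℤ) :
    wt (((((ζ : (𝓞 K)ˣ) * ∏ i, (fundSystem K i) ^ (k i)) : (𝓞 K)ˣ) : 𝓞 K) * a) =
      ∏ i, tent ((ybasis K).repr (logMap (mixedEmbedding K (a : K))) i + k i) := by
  unfold wt
  refine Finset.prod_congr rfl fun i _ => ?_
  congr 1
  have h1 := logMap_unit_smul ((ζ : (𝓞 K)ˣ) * ∏ i, (fundSystem K i) ^ (k i) : (𝓞 K)ˣ)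
    (norm_emb_ne_zero ha)
  rw [unitSMul_smul, ← map_mul] at h1
  have h2 : logEmbedding K (Additive.ofMul ((ζ : (𝓞 K)ˣ) * ∏ i, (fundSystem K i) ^ (k i))) =
      ∑ i, (k i : ℝ) • ybasis K i := by
    rw [ofMul_mul, map_add, logEmbedding_eq_zero_iff.mpr ζ.2, zero_add, ofMul_prod, map_sum]
    refine Finset.sum_congr rfl fun i _ => ?_
    rw [ofMul_zpow, map_zsmul, logEmbedding_fundSystem, ybasis, Basis.ofZLatticeBasis_apply]
    exact (Int.cast_smul_eq_zsmul ℝ _ _).symm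
  rw [RingOfIntegers.coe_eq_algebraMap, map_mul, h1, h2, map_add]
  simp [Finsupp.single_apply, add_comm, Basis.repr_self]

lemma wt_hasSum {a : 𝓞 K} (ha : a ≠ 0) :
    HasSum (fun u : (𝓞 K)ˣ => wt ((u : 𝓞 K) * a)) (torsionOrder K) := by
  classical
  let _ := Fintype.ofFinite (torsion K)
  let e : torsion K × (Fin (rank K) → ℤ) → (𝓞 K)ˣ :=
    fun ζe => ζe.1 * ∏ i, (fundSystem K i) ^ (ζe.2 i)
  have he : Function.Bijective e := by
    constructor
    · intro x y hxy
      exact (exist_unique_eq_mul_prod K (e x)).unique rfl hxy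
    · intro u
      obtain ⟨x, hx, -⟩ := exist_unique_eq_mul_prod K u
      exact ⟨x, hx.symm⟩
  rw [← (Equiv.ofBijective e he).hasSum_iff]
  choose A hA hA1 using fun i => tent_sum ((ybasis K).repr (logMap (mixedEmbedding K (a : K))) i)
  have key : (torsionOrder K : ℝ) = ∑ x ∈ (Finset.univ : Finset (torsion K)) ×ˢ Fintype.piFinset A,
      wt ((e x : 𝓞 K) * a) := by
    rw [Finset.sum_product]
    simp only [e, wt_unit ha]
    rw [Finset.sum_const, ← Finset.prod_univ_sum A (fun i k =>
      tent ((ybasis K).repr (logMap (mixedEmbedding K (a : K))) i + k)), Finset.prod_eq_one fun i _ => hA1 i]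
    simp [torsionOrder, Nat.card_eq_fintype_card]
  rw [key]
  refine hasSum_sum_of_ne_finset_zero fun x hx => ?_
  simp only [Finset.mem_product, Finset.mem_univ, true_and, Fintype.mem_piFinset, not_forall] at hx
  obtain ⟨i, hi⟩ := hx
  show wt ((e x : 𝓞 K) * a) = 0
  simp only [e, wt_unit ha]
  exact Finset.prod_eq_zero (Finset.mem_univ i) (hA i _ hi)

end Weight
section Lip
open NumberField.Units NumberField.Units.dirichletUnitTheorem NumberField.mixedEmbedding Module

lemma prod_sub_prod_le {ι : Type*} (s : Finset ι) (f g : ι → ℝ) (hf : ∀ i, 0 ≤ f i ∧ f i ≤ 1)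
    (hg : ∀ i, 0 ≤ g i ∧ g i ≤ 1) :
    |∏ i ∈ s, f i - ∏ i ∈ s, g i| ≤ ∑ i ∈ s, |f i - g i| := by
  classical
  induction s using Finset.induction_on with
  | empty => simp
  | insert a s ha ih =>
    rw [Finset.prod_insert ha, Finset.prod_insert ha, Finset.sum_insert ha]
    have h1 : |∏ i ∈ s, g i| ≤ 1 := by
      rw [abs_of_nonneg (Finset.prod_nonneg fun i _ => (hg i).1)]
      exact Finset.prod_le_one (fun i _ => (hg i).1) (fun i _ => (hg i).2)
    have h2 : |f a| ≤ 1 := by rw [abs_of_nonneg (hf a).1]; exact (hf a).2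
    calc |f a * ∏ i ∈ s, f i - g a * ∏ i ∈ s, g i|
        = |f a * (∏ i ∈ s, f i - ∏ i ∈ s, g i) + (f a - g a) * ∏ i ∈ s, g i| := by
          congr 1; ring
      _ ≤ |f a| * |∏ i ∈ s, f i - ∏ i ∈ s, g i| + |f a - g a| * |∏ i ∈ s, g i| := by
          rw [← abs_mul, ← abs_mul]; exact abs_add_le _ _
      _ ≤ 1 * |∏ i ∈ s, f i - ∏ i ∈ s, g i| + |f a - g a| * 1 := by gcongr
      _ ≤ _ := by linarith

variable {K : Type*} [Field K] [NumberField K]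

open scoped Classical in
noncomputable def MM (a : 𝓞 K) : ℝ := ‖mixedEmbedding K (a : K)‖
noncomputable def NN (a : 𝓞 K) : ℝ := mixedEmbedding.norm (mixedEmbedding K (a : K))
noncomputable def FF (s : ℝ) (a : 𝓞 K) : ℝ := wt a * (NN a) ^ (-s)

lemma le_MM (a : 𝓞 K) (v : InfinitePlace K) : v (a : K) ≤ MM a := by
  unfold MM
  rw [norm_eq_sup'_normAtPlace, ← normAtPlace_apply]
  exact Finset.le_sup' (fun w => normAtPlace w (mixedEmbedding K (a : K))) (Finset.mem_univ v)

lemma exists_MM (a : 𝓞 K) : ∃ v : InfinitePlace K, v (a : K) = MM a := by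
  unfold MM
  rw [norm_eq_sup'_normAtPlace]
  obtain ⟨v, -, hv⟩ := Finset.exists_mem_eq_sup' (s := Finset.univ) Finset.univ_nonempty (fun w : InfinitePlace K => normAtPlace w (mixedEmbedding K (a : K)))
  exact ⟨v, by rw [hv, normAtPlace_apply]⟩

lemma MM_nonneg (a : 𝓞 K) : 0 ≤ MM a := by
  obtain ⟨v, hv⟩ := exists_MM a
  rw [← hv]; exact apply_nonneg v _
lemma MM_zero : MM (0 : 𝓞 K) = 0 := by
  obtain ⟨v, hv⟩ := exists_MM (0 : 𝓞 K)
  rw [← hv]; simp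

lemma MM_pos {a : 𝓞 K} (ha : a ≠ 0) : 0 < MM a := by
  obtain ⟨v, hv⟩ := exists_MM a
  rw [← hv]
  exact InfinitePlace.pos_iff.mpr (by simpa using ha)

lemma NN_eq (a : 𝓞 K) : NN a = |Algebra.norm ℤ a| := by
  unfold NN
  rw [norm_eq_norm, ← Algebra.coe_norm_int]
  simp

lemma NN_zero : NN (0 : 𝓞 K) = 0 := by simp [NN_eq]

lemma NN_ge {a : 𝓞 K} (ha : a ≠ 0) : 1 ≤ NN a := by
  rw [NN_eq]
  have : Algebra.norm ℤ a ≠ 0 := Algebra.norm_ne_zero_iff.mpr ha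
  exact_mod_cast Int.one_le_abs this

lemma FF_zero {s : ℝ} (hs : 0 < s) : FF s (0 : 𝓞 K) = 0 := by
  rw [FF, NN_zero, Real.zero_rpow (by linarith), mul_zero]

lemma FF_nonneg (s : ℝ) (a : 𝓞 K) : 0 ≤ FF s a := by
  unfold FF
  rw [NN_eq]
  exact mul_nonneg (wt_nonneg a) (by positivity)

lemma FF_le_one {s : ℝ} (hs : 0 < s) (a : 𝓞 K) : FF s a ≤ 1 := by
  by_cases ha : a = 0
  · rw [ha, FF_zero hs]; exact zero_le_one
  · refine mul_le_one₀ (wt_le_one a) ?_ ?_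
    · rw [NN_eq]; positivity
    · exact Real.rpow_le_one_of_one_le_of_nonpos (NN_ge ha) (by linarith)

noncomputable def lam (a : 𝓞 K) (w : InfinitePlace K) : ℝ := Real.log (w (a : K))
variable (K) in
noncomputable def tau : (InfinitePlace K → ℝ) →ₗ[ℝ] ℝ where
  toFun l := ∑ w, w.mult * l w
  map_add' x y := by simp [mul_add, Finset.sum_add_distrib]
  map_smul' c x := by simp [Finset.mul_sum, mul_left_comm]

variable (K) in
noncomputable def lmap : (InfinitePlace K → ℝ) →ₗ[ℝ] logSpace K where
  toFun l := fun w => w.val.mult * (l w.val - tau K l * (finrank ℚ K : ℝ)⁻¹)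
  map_add' x y := by ext; simp; ring
  map_smul' c x := by ext; simp; ring

lemma place_pos {a : 𝓞 K} (ha : a ≠ 0) (v : InfinitePlace K) : 0 < v (a : K) :=
  InfinitePlace.pos_iff.mpr (by simpa using ha)

lemma log_NN {a : 𝓞 K} (ha : a ≠ 0) : Real.log (NN a) = tau K (lam a) := by
  unfold NN
  rw [mixedEmbedding.norm_apply, Real.log_prod]
  · simp [tau, lam, Real.log_pow, normAtPlace_apply]
  · intro v _
    rw [normAtPlace_apply]
    exact pow_ne_zero _ (place_pos ha v).ne'

lemma NN_exp {a : 𝓞 K} (ha : a ≠ 0) : NN a = Real.exp (tau K (lam a)) := by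
  rw [← log_NN ha, Real.exp_log]; linarith [NN_ge ha]

lemma logMap_lmap {a : 𝓞 K} (ha : a ≠ 0) :
    logMap (mixedEmbedding K (a : K)) = lmap K (lam a) := by
  ext w
  rw [logMap_apply]
  simp only [lmap, LinearMap.coe_mk, AddHom.coe_mk]
  rw [← log_NN ha, lam, normAtPlace_apply, NN]

lemma wt_lip : ∃ C : ℝ, 0 ≤ C ∧ ∀ a b : 𝓞 K, a ≠ 0 → b ≠ 0 →
    |wt b - wt a| ≤ C * ‖lam b - lam a‖ := by
  let ℓ : Fin (rank K) → (InfinitePlace K → ℝ) →L[ℝ] ℝ := fun i =>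
    LinearMap.toContinuousLinearMap (((ybasis K).coord i).comp (lmap K))
  refine ⟨∑ i, ‖ℓ i‖, by positivity, fun a b ha hb => ?_⟩
  unfold wt
  refine (prod_sub_prod_le _ _ _ (fun i => ⟨tent_nonneg _, tent_le_one _⟩) (fun i => ⟨tent_nonneg _, tent_le_one _⟩)).trans ?_
  rw [Finset.sum_mul]
  refine Finset.sum_le_sum fun i _ => (tent_lip _ _).trans ?_
  rw [logMap_lmap ha, logMap_lmap hb]
  have : (ybasis K).repr (lmap K (lam b)) i - (ybasis K).repr (lmap K (lam a)) i
    = ℓ i (lam b - lam a) := by rw [map_sub]; rfl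
  rw [this]
  exact (ℓ i).le_opNorm _

lemma wt_supp : ∃ B : ℝ, 0 ≤ B ∧ ∀ a : 𝓞 K, a ≠ 0 → wt a ≠ 0 → ∀ v : InfinitePlace K,
    |lam a v - tau K (lam a) * (finrank ℚ K : ℝ)⁻¹| ≤ B := by
  classical
  set B0 : ℝ := ∑ i, ‖ybasis K i‖
  have hB0 : 0 ≤ B0 := by positivity
  refine ⟨(Fintype.card (InfinitePlace K) + 1) * B0, by positivity, fun a ha hw v => ?_⟩
  have h1 : ∀ i, |(ybasis K).repr (lmap K (lam a)) i| ≤ 1 := by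
    intro i
    apply tent_ne_zero
    have := Finset.prod_ne_zero_iff.mp hw i (Finset.mem_univ i)
    rwa [logMap_lmap ha] at this
  have h2 : ‖lmap K (lam a)‖ ≤ B0 := by
    rw [← (ybasis K).sum_repr (lmap K (lam a))]
    refine (norm_sum_le _ _).trans (Finset.sum_le_sum fun i _ => ?_)
    rw [_root_.norm_smul]
    exact mul_le_of_le_one_left (norm_nonneg _) (h1 i)
  set T := tau K (lam a) * (finrank ℚ K : ℝ)⁻¹ with hT
  have hm : ∀ v : InfinitePlace K, (1:ℝ) ≤ v.mult := fun v => by exact_mod_cast v.one_le_mult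
  have h3 : ∀ w : InfinitePlace K, w ≠ w₀ → |w.mult * (lam a w - T)| ≤ B0 := by
    intro w hw
    have := (norm_le_pi_norm (lmap K (lam a)) ⟨w, hw⟩).trans h2
    simpa [lmap] using this
  have hred : ∀ w : InfinitePlace K, |lam a w - T| ≤ |w.mult * (lam a w - T)| := by
    intro w
    rw [abs_mul, abs_of_nonneg (zero_le_one.trans (hm w))]
    exact le_mul_of_one_le_left (abs_nonneg _) (hm w)
  refine (hred v).trans ?_
  by_cases hv : v = w₀
  · have hsum : ∑ w : InfinitePlace K, (w.mult : ℝ) * (lam a w - T) = 0 := by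
      simp only [mul_sub, Finset.sum_sub_distrib]
      rw [← Finset.sum_mul, ← Nat.cast_sum, InfinitePlace.sum_mult_eq, hT]
      have : (finrank ℚ K : ℝ) ≠ 0 := by exact_mod_cast finrank_pos.ne'
      field_simp
      simp [tau]
    rw [← Finset.add_sum_erase _ _ (Finset.mem_univ v)] at hsum
    rw [eq_neg_of_add_eq_zero_left hsum, abs_neg]
    refine (Finset.abs_sum_le_sum_abs _ _).trans ((Finset.sum_le_card_nsmul _ _ B0 ?_).trans ?_)
    · intro w hw
      exact h3 w (by rw [← hv]; exact Finset.ne_of_mem_erase hw)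
    · rw [nsmul_eq_mul]
      gcongr
      have := Finset.card_le_univ (Finset.univ.erase v : Finset (InfinitePlace K))
      have : ((Finset.univ.erase v : Finset (InfinitePlace K)).card : ℝ) ≤ Fintype.card (InfinitePlace K) := by exact_mod_cast this
      linarith
  · refine (h3 v hv).trans ?_
    have : (0:ℝ) ≤ Fintype.card (InfinitePlace K) := by positivity
    nlinarith
lemma wt_supp' : ∃ c : ℝ, 0 < c ∧ c ≤ 1 ∧ ∀ a : 𝓞 K, a ≠ 0 → wt a ≠ 0 →
    (∀ v : InfinitePlace K, c * MM a ≤ v (a : K)) ∧ c * MM a ^ (finrank ℚ K) ≤ NN a := by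
  obtain ⟨B, hB, h⟩ := wt_supp (K := K)
  set n := finrank ℚ K with hn
  have hn0 : (n : ℝ) ≠ 0 := by exact_mod_cast (finrank_pos (R := ℚ) (M := K)).ne'
  have hn1 : (1 : ℝ) ≤ n := by exact_mod_cast (finrank_pos (R := ℚ) (M := K))
  refine ⟨Real.exp (-(2 * n * B)), Real.exp_pos _, ?_, fun a ha hw => ?_⟩
  · rw [Real.exp_le_one_iff]; nlinarith
  set T := tau K (lam a) with hT
  have h1 := h a ha hw
  have hv : ∀ v : InfinitePlace K, v (a : K) = Real.exp (lam a v) := fun v => by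
    rw [lam, Real.exp_log (place_pos ha v)]
  obtain ⟨v0, hv0⟩ := exists_MM a
  have hM : MM a ≤ Real.exp (T * (n : ℝ)⁻¹ + B) := by
    rw [← hv0, hv]
    apply Real.exp_le_exp.mpr
    linarith [(abs_le.mp (h1 v0)).2]
  constructor
  · intro v
    calc _ ≤ Real.exp (-(2 * n * B)) * Real.exp (T * (n : ℝ)⁻¹ + B) := by gcongr
      _ ≤ v (a : K) := by
        rw [hv, ← Real.exp_add]
        apply Real.exp_le_exp.mpr
        have := (abs_le.mp (h1 v)).1
        nlinarith
  · calc _ ≤ Real.exp (-(2 * n * B)) * Real.exp (T * (n : ℝ)⁻¹ + B) ^ n := by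
          gcongr
          exact (MM_pos ha).le
      _ ≤ NN a := by
        rw [NN_exp ha, ← Real.exp_nat_mul, ← Real.exp_add]
        apply Real.exp_le_exp.mpr
        rw [mul_add, mul_comm T, ← mul_assoc, mul_inv_cancel₀ hn0, one_mul]
        nlinarith

lemma log_sub_le {x y c : ℝ} (hx : 0 < x) (hr : |y - x| ≤ x / 2) (hc : |y - x| ≤ c * x) :
    |Real.log y - Real.log x| ≤ 2 * c := by
  have hy : x / 2 ≤ y := by linarith [(abs_le.mp hr).1]
  have hy0 : 0 < y := by linarith
  have h1 : Real.log y - Real.log x ≤ (y - x) / x := by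
    rw [← Real.log_div hy0.ne' hx.ne']
    have := Real.log_le_sub_one_of_pos (div_pos hy0 hx)
    rw [sub_div, div_self hx.ne']; exact this
  have h2 : Real.log x - Real.log y ≤ (x - y) / y := by
    rw [← Real.log_div hx.ne' hy0.ne']
    have := Real.log_le_sub_one_of_pos (div_pos hx hy0)
    rw [sub_div, div_self hy0.ne']; exact this
  have hc0 : 0 ≤ c := by
    by_contra h
    have := abs_nonneg (y - x)
    nlinarith
  have h3 : (y - x) / x ≤ c := by
    rw [div_le_iff₀ hx]; exact (le_abs_self _).trans hc
  have h4 : (x - y) / y ≤ 2 * c := by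
    rw [div_le_iff₀ hy0]
    have := (neg_le_abs (y - x)).trans hc
    nlinarith
  rw [abs_le]; constructor <;> linarith

lemma FF_exp {a : 𝓞 K} (ha : a ≠ 0) (s : ℝ) : FF s a = wt a * Real.exp (- s * tau K (lam a)) := by
  rw [FF, NN_exp ha, ← Real.exp_mul, mul_comm (tau K (lam a))]

lemma FF_l1 : ∃ c C : ℝ, 0 < c ∧ c ≤ 1 / 2 ∧ 0 ≤ C ∧ ∀ s : ℝ, 1 < s → s ≤ 2 → ∀ a b : 𝓞 K, ∀ r : ℝ,
    a ≠ 0 → b ≠ 0 → wt a ≠ 0 → (∀ v : InfinitePlace K, |v (b : K) - v (a : K)| ≤ r) →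
    r ≤ c * MM a → |FF s b - FF s a| ≤ C * r * (MM a ^ (finrank ℚ K + 1))⁻¹ := by
  obtain ⟨c0, hc0, hc01, hc⟩ := wt_supp' (K := K)
  obtain ⟨C1, hC1, hlip⟩ := wt_lip (K := K)
  set n := finrank ℚ K with hn
  have hn1 : (1 : ℝ) ≤ n := by exact_mod_cast (finrank_pos (R := ℚ) (M := K))
  refine ⟨c0 / (4 * n), (C1 + 4 * n) * (2 * c0⁻¹) * c0⁻¹, by positivity, ?_, by positivity, ?_⟩
  · rw [div_le_iff₀ (by positivity)]; nlinarith
  intro s hs hs2 a b r ha hb hw hv hr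
  obtain ⟨hp, hN⟩ := hc a ha hw
  have hM := MM_pos ha
  have hr0 : 0 ≤ r := (abs_nonneg _).trans (hv (Classical.arbitrary _))
  have hr1 : 4 * n * r ≤ c0 * MM a := by
    rw [div_mul_eq_mul_div, le_div_iff₀ (by positivity)] at hr; linarith
  -- log difference
  set δ := ‖lam b - lam a‖ with hδ
  have hδ1 : δ ≤ 2 * (c0⁻¹ * r * (MM a)⁻¹) := by
    rw [hδ, pi_norm_le_iff_of_nonneg (by positivity)]
    intro v
    rw [Pi.sub_apply, Real.norm_eq_abs]
    refine log_sub_le (place_pos ha v) ((hv v).trans ?_) ((hv v).trans ?_)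
    · have := hp v; nlinarith
    · calc r = c0⁻¹ * r * (MM a)⁻¹ * (c0 * MM a) := by field_simp
        _ ≤ _ := by gcongr; exact hp v
  have hδ0 : 0 ≤ δ := norm_nonneg _
  have hδ2 : 2 * n * δ ≤ 1 := by
    calc 2 * n * δ ≤ 2 * n * (2 * (c0⁻¹ * r * (MM a)⁻¹)) := by gcongr
      _ = (4 * n * r) * (c0 * MM a)⁻¹ := by rw [mul_inv]; ring
      _ ≤ (c0 * MM a) * (c0 * MM a)⁻¹ := by gcongr
      _ = 1 := mul_inv_cancel₀ (by positivity)
  have htau : |tau K (lam b) - tau K (lam a)| ≤ n * δ := by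
    rw [← map_sub]
    simp only [tau, LinearMap.coe_mk, AddHom.coe_mk]
    refine (Finset.abs_sum_le_sum_abs _ _).trans ?_
    rw [hn, ← InfinitePlace.sum_mult_eq, Nat.cast_sum, Finset.sum_mul]
    refine Finset.sum_le_sum fun v _ => ?_
    rw [abs_mul, Nat.abs_cast]
    gcongr
    exact norm_le_pi_norm (lam b - lam a) v
  have hx : |- s * (tau K (lam b) - tau K (lam a))| ≤ 2 * n * δ := by
    rw [abs_mul, abs_neg, abs_of_pos (by linarith)]
    have := abs_nonneg (tau K (lam b) - tau K (lam a))
    nlinarith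
  have hexp : |Real.exp (- s * (tau K (lam b) - tau K (lam a))) - 1| ≤ 4 * n * δ := by
    refine (Real.abs_exp_sub_one_le (hx.trans hδ2)).trans ?_
    linarith
  have hbase : Real.exp (- s * tau K (lam a)) ≤ c0⁻¹ * (MM a ^ n)⁻¹ := by
    have h1 : 0 ≤ tau K (lam a) := by rw [← log_NN ha]; exact Real.log_nonneg (NN_ge ha)
    calc _ ≤ Real.exp (- tau K (lam a)) := Real.exp_le_exp.mpr (by nlinarith)
      _ = (NN a)⁻¹ := by rw [Real.exp_neg, NN_exp ha]
      _ ≤ (c0 * MM a ^ n)⁻¹ := by gcongr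
      _ = _ := by rw [mul_inv]
  have key : FF s b - FF s a = Real.exp (- s * tau K (lam a)) * ((wt b - wt a) +
      wt b * (Real.exp (- s * (tau K (lam b) - tau K (lam a))) - 1)) := by
    rw [FF_exp ha, FF_exp hb, mul_sub (- s), Real.exp_sub]
    have := (Real.exp_pos (- s * tau K (lam a))).ne'
    field_simp
    ring
  rw [key, abs_mul, abs_of_pos (Real.exp_pos _)]
  calc _ ≤ c0⁻¹ * (MM a ^ n)⁻¹ * (C1 * δ + 1 * (4 * n * δ)) := by
        gcongr
        refine (abs_add_le _ _).trans (add_le_add (hlip a b ha hb) ?_)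
        rw [abs_mul, abs_of_nonneg (wt_nonneg b)]
        gcongr
        exact wt_le_one b
    _ = c0⁻¹ * (MM a ^ n)⁻¹ * (C1 + 4 * n) * δ := by ring
    _ ≤ c0⁻¹ * (MM a ^ n)⁻¹ * (C1 + 4 * n) * (2 * (c0⁻¹ * r * (MM a)⁻¹)) := by gcongr
    _ = _ := by rw [pow_succ, mul_inv]; ring

set_option maxHeartbeats 1000000 in
lemma FF_lip (c : 𝓞 K) : ∃ C : ℝ, 0 ≤ C ∧ ∀ s : ℝ, 1 < s → s ≤ 2 → ∀ a : 𝓞 K, a ≠ 0 →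
    |FF s (a + c) - FF s a| ≤ C * (MM a ^ (finrank ℚ K + 1))⁻¹ := by
  obtain ⟨k, C, hk, hk2, hC, h⟩ := FF_l1 (K := K)
  generalize finrank ℚ K = n at h ⊢
  obtain ⟨r, hr⟩ : ∃ r, r = MM c := ⟨_, rfl⟩
  have hr0 : 0 ≤ r := hr ▸ MM_nonneg c
  obtain ⟨R, hR⟩ : ∃ R, R = 2 * r / k := ⟨_, rfl⟩
  have hR0 : 0 ≤ R := by rw [hR]; positivity
  refine ⟨C * r * 2 ^ (n + 1) + R ^ (n + 1), by positivity, fun s hs hs2 a ha => ?_⟩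
  have hM := MM_pos ha
  have hd : ∀ v : InfinitePlace K, |v ((a + c : 𝓞 K) : K) - v (a : K)| ≤ r := by
    intro v
    rw [hr]
    refine le_trans ?_ (le_MM c v)
    have h1 : v ((a + c : 𝓞 K) : K) ≤ v (a : K) + v (c : K) := by
      have h3 := normAtPlace_add_le v (mixedEmbedding K (a : K)) (mixedEmbedding K (c : K))
      rw [← map_add, normAtPlace_apply, normAtPlace_apply, normAtPlace_apply] at h3
      simpa using h3
    have h2 : v (a : K) ≤ v ((a + c : 𝓞 K) : K) + v (c : K) := by
      have h3 := normAtPlace_add_le v (mixedEmbedding K ((a + c : 𝓞 K) : K)) (-mixedEmbedding K (c : K))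
      rw [normAtPlace_neg, ← map_neg, ← map_add, normAtPlace_apply, normAtPlace_apply, normAtPlace_apply] at h3
      simpa using h3
    rw [abs_le]; constructor <;> linarith
  rcases le_or_gt (MM a) R with hle | hgt
  · calc _ ≤ 1 := by
          rw [abs_le]
          have := FF_nonneg s a
          have := FF_nonneg s (a + c)
          have := FF_le_one (show 0 < s by linarith) a
          have := FF_le_one (show 0 < s by linarith) (a + c)
          constructor <;> linarith
      _ = MM a ^ (n + 1) * (MM a ^ (n + 1))⁻¹ := (mul_inv_cancel₀ (by positivity)).symm
      _ ≤ R ^ (n + 1) * (MM a ^ (n + 1))⁻¹ := by gcongr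
      _ ≤ _ := by gcongr; exact le_add_of_nonneg_left (by positivity)
  · have h2r : 2 * r < k * MM a := by
      rw [hR, div_lt_iff₀ hk] at hgt; linarith
    have hMb : MM a / 2 ≤ MM (a + c) := by
      obtain ⟨v, hv⟩ := exists_MM a
      have h1 := (abs_le.mp (hd v)).1
      have := le_MM (a + c) v
      nlinarith
    have hb : a + c ≠ 0 := by
      intro h0
      rw [h0] at hMb
      rw [MM_zero] at hMb
      linarith
    have hgoal : ∀ t : ℝ, MM a / 2 ≤ t → C * r * (t ^ (n + 1))⁻¹ ≤
        (C * r * 2 ^ (n + 1) + R ^ (n + 1)) * (MM a ^ (n + 1))⁻¹ := by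
      intro t ht
      calc _ ≤ C * r * ((MM a / 2) ^ (n + 1))⁻¹ := by gcongr
        _ = C * r * 2 ^ (n + 1) * (MM a ^ (n + 1))⁻¹ := by rw [div_pow, inv_div]; ring
        _ ≤ _ := by gcongr; exact le_add_of_nonneg_right (by positivity)
    by_cases hwa : wt a = 0
    · by_cases hwb : wt (a + c) = 0
      · rw [FF, FF, hwa, hwb]; simp; positivity
      · rw [abs_sub_comm]
        refine (h s hs hs2 (a + c) a r hb ha hwb ?_ ?_).trans (hgoal _ hMb)
        · intro v; rw [abs_sub_comm]; exact hd v
        · nlinarith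
    · refine (h s hs hs2 a (a + c) r ha hb hwa hd ?_).trans (hgoal _ (by linarith))
      linarith

lemma MM_summable (r : ℝ) (hr : (finrank ℚ K : ℝ) < r) : Summable fun a : 𝓞 K => (MM a) ^ (-r) := by
  classical
  have h1 : finrank ℤ (mixedEmbedding.integerLattice K) = finrank ℚ K := by
    rw [ZLattice.rank ℝ, mixedEmbedding.finrank]
  have := ZLattice.summable_norm_rpow (mixedEmbedding.integerLattice K) (-r) (by
    rw [h1]; linarith)
  let f : 𝓞 K → mixedEmbedding.integerLattice K := fun a => ⟨mixedEmbedding K (a : K), ⟨a, rfl⟩⟩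
  have hf : Function.Injective f := by
    intro a b hab
    have := congrArg Subtype.val hab
    exact RingOfIntegers.ext (mixedEmbedding_injective K this)
  have h2 := this.comp_injective hf
  refine h2.congr fun a => ?_
  simp only [Function.comp, MM, f]
  rfl

lemma FF_summable {s : ℝ} (hs : 1 < s) : Summable fun a : 𝓞 K => FF s a := by
  obtain ⟨c, hc, hc1, h⟩ := wt_supp' (K := K)
  have hn1 : (1 : ℝ) ≤ finrank ℚ K := by exact_mod_cast (finrank_pos (R := ℚ) (M := K))
  refine Summable.of_nonneg_of_le (FF_nonneg s) (fun a => ?_)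
    ((MM_summable (K := K) (finrank ℚ K * s) (by nlinarith)).mul_left (c ^ (-s)))
  by_cases ha : a = 0
  · rw [ha, FF_zero (by linarith)]
    exact mul_nonneg (by positivity) (Real.rpow_nonneg (MM_nonneg _) _)
  by_cases hw : wt a = 0
  · rw [FF, hw, zero_mul]
    exact mul_nonneg (by positivity) (Real.rpow_nonneg (MM_nonneg _) _)
  have hM := MM_pos ha
  calc FF s a ≤ 1 * (NN a) ^ (-s) := by
        unfold FF
        gcongr
        · exact Real.rpow_nonneg (by linarith [NN_ge ha]) _
        · exact wt_le_one a
    _ ≤ (c * MM a ^ finrank ℚ K) ^ (-s) := by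
        rw [one_mul]
        exact Real.rpow_le_rpow_of_nonpos (by positivity) (h a ha hw).2 (by linarith)
    _ = _ := by
        rw [Real.mul_rpow hc.le (by positivity), ← Real.rpow_natCast, ← Real.rpow_mul hM.le]
        ring_nf

lemma FF_sum_bound (c : 𝓞 K) : ∃ C : ℝ, ∀ s : ℝ, 1 < s → s ≤ 2 → ∀ A : Finset (𝓞 K),
    ∑ a ∈ A, |FF s (a + c) - FF s a| ≤ C := by
  obtain ⟨C, hC, h⟩ := FF_lip c
  have hsum := (MM_summable (K := K) ((finrank ℚ K + 1 : ℕ) : ℝ) (by push_cast; linarith))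
  refine ⟨1 + C * ∑' a : 𝓞 K, (MM a) ^ (-((finrank ℚ K + 1 : ℕ) : ℝ)), fun s hs hs2 A => ?_⟩
  classical
  calc _ ≤ ∑ a ∈ insert 0 A, |FF s (a + c) - FF s a| :=
        Finset.sum_le_sum_of_subset_of_nonneg (Finset.subset_insert _ _) (fun _ _ _ => abs_nonneg _)
    _ = |FF s (0 + c) - FF s 0| + ∑ a ∈ (insert 0 A).erase 0, |FF s (a + c) - FF s a| :=
        (Finset.add_sum_erase _ _ (Finset.mem_insert_self _ _)).symm
    _ ≤ 1 + ∑ a ∈ (insert 0 A).erase 0, C * (MM a) ^ (-((finrank ℚ K + 1 : ℕ) : ℝ)) := by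
        gcongr with a ha
        · rw [FF_zero (by linarith), sub_zero, abs_of_nonneg (FF_nonneg _ _)]
          exact FF_le_one (by linarith) _
        · rw [Real.rpow_neg (MM_nonneg a), Real.rpow_natCast]
          exact h s hs hs2 a (Finset.ne_of_mem_erase ha)
    _ ≤ _ := by
        rw [← Finset.mul_sum]
        gcongr
        exact hsum.sum_le_tsum _ (fun a _ => Real.rpow_nonneg (MM_nonneg _) _)
end Lip

section Bdd
open NumberField.Units Module Ideal

variable {K : Type*} [Field K] [NumberField K] {n : ℕ} [NeZero n]

noncomputable def gg (χ : DirichletCharacter ℂ n) (a : 𝓞 K) : ℂ :=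
  χ ((absNorm (span {a}) : ℕ) : ZMod n)

noncomputable def EE (χ : DirichletCharacter ℂ n) (s : ℝ) (J : Ideal (𝓞 K)) : ℂ :=
  ∑' a : J, gg χ (a : 𝓞 K) * FF s (a : 𝓞 K)

lemma gg_le (χ : DirichletCharacter ℂ n) (a : 𝓞 K) : ‖gg χ a‖ ≤ 1 := χ.norm_le_one _

lemma gF_summable (χ : DirichletCharacter ℂ n) {s : ℝ} (hs : 1 < s) :
    Summable fun a : 𝓞 K => gg χ a * (FF s a : ℂ) := by
  refine Summable.of_norm_bounded (FF_summable (K := K) hs) fun a => ?_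
  rw [norm_mul, Complex.norm_real, Real.norm_of_nonneg (FF_nonneg s a)]
  exact mul_le_of_le_one_left (FF_nonneg s a) (gg_le χ a)

lemma tsum_equiv_prod {α β X : Type*} (e : α × β ≃ X) (f : X → ℂ) (hf : Summable f) :
    ∑' x, f x = ∑' a, ∑' b, f (e (a, b)) := by
  have hse : Summable (fun c => f (e c)) := e.summable_iff.mpr hf
  rw [← e.tsum_eq, hse.tsum_prod]

lemma summable_equiv_prod {α β X : Type*} (e : α × β ≃ X) (f : X → ℂ) (hf : Summable f) (a : α) :
    Summable fun b => f (e (a, b)) := by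
  have hse : Summable (fun c => f (e c)) := e.summable_iff.mpr hf
  exact hse.comp_injective (i := fun b => (a, b)) (fun x y h => (Prod.mk.inj h).2)

lemma EE_shift (χ : DirichletCharacter ℂ n)
    (hdep : ∀ a b : 𝓞 K, ((absNorm (span {a + n * b}) : ℕ) : ZMod n) = (absNorm (span {a}) : ℕ))
    (J : Ideal (𝓞 K)) (hJ0 : J ≠ ⊥) (hJ : J ⊔ span {(n : 𝓞 K)} = ⊤) :
    ∃ C : ℝ, ∀ s : ℝ, 1 < s → s ≤ 2 →
      ‖(∑' a : 𝓞 K, gg χ a * (FF s a : ℂ)) - absNorm J * EE χ s J‖ ≤ C := by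
  classical
  have hrep : ∀ q : 𝓞 K ⧸ J, ∃ b : 𝓞 K, Ideal.Quotient.mk J (n * b) = q := by
    intro q
    obtain ⟨x, rfl⟩ := Ideal.Quotient.mk_surjective q
    have : (1 : 𝓞 K) ∈ J ⊔ span {(n : 𝓞 K)} := hJ ▸ Submodule.mem_top
    obtain ⟨y, hy, z, hz, hyz⟩ := Submodule.mem_sup.mp this
    obtain ⟨w, rfl⟩ := mem_span_singleton'.mp hz
    refine ⟨w * x, ?_⟩
    rw [Ideal.Quotient.eq]
    have : (n : 𝓞 K) * (w * x) - x = - (y * x) := by linear_combination x * hyz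
    rw [this]
    exact J.neg_mem (J.mul_mem_right _ hy)
  choose b hb using hrep
  have : Finite (𝓞 K ⧸ J) := Ideal.finiteQuotientOfFreeOfNeBot J hJ0
  have : Fintype (𝓞 K ⧸ J) := Fintype.ofFinite _
  have hcard : (absNorm J : ℂ) = Fintype.card (𝓞 K ⧸ J) := by
    rw [absNorm_apply, Submodule.cardQuot_apply, Nat.card_eq_fintype_card]
  obtain ⟨e, he⟩ : ∃ e : (𝓞 K ⧸ J) × J ≃ 𝓞 K, ∀ q j, e (q, j) = (j : 𝓞 K) + n * b q := by
    refine ⟨Equiv.ofBijective (fun p => (p.2 : 𝓞 K) + n * b p.1) ⟨?_, ?_⟩, fun q j => rfl⟩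
    · rintro ⟨q, j⟩ ⟨q', j'⟩ h
      dsimp only at h
      have h1 := congrArg (Ideal.Quotient.mk J) h
      rw [map_add, map_add, hb, hb, Ideal.Quotient.eq_zero_iff_mem.mpr j.2,
        Ideal.Quotient.eq_zero_iff_mem.mpr j'.2, zero_add, zero_add] at h1
      subst h1
      simpa using h
    · intro x
      refine ⟨⟨Ideal.Quotient.mk J x, ⟨x - n * b (Ideal.Quotient.mk J x), ?_⟩⟩, by simp⟩
      rw [← Ideal.Quotient.eq_zero_iff_mem, map_sub, hb, sub_self]
  choose C hC using fun c : 𝓞 K => FF_sum_bound c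
  refine ⟨∑ q : 𝓞 K ⧸ J, C (n * b q), fun s hs hs2 => ?_⟩
  have hsum := gF_summable (K := K) χ hs
  have hsumJ : Summable fun a : J => gg χ (a : 𝓞 K) * (FF s (a : 𝓞 K) : ℂ) :=
    hsum.comp_injective Subtype.val_injective
  have h1 : ∑' a : 𝓞 K, gg χ a * (FF s a : ℂ) =
      ∑ q : 𝓞 K ⧸ J, ∑' j : J, gg χ (j : 𝓞 K) * (FF s (j + n * b q : 𝓞 K) : ℂ) := by
    rw [tsum_equiv_prod e _ hsum, tsum_fintype]
    refine Finset.sum_congr rfl fun q _ => tsum_congr fun j => ?_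
    rw [he, gg, hdep, ← gg]
  rw [h1, hcard, ← nsmul_eq_mul, ← Finset.card_univ, ← Finset.sum_const, ← Finset.sum_sub_distrib]
  refine (norm_sum_le _ _).trans (Finset.sum_le_sum fun q _ => ?_)
  have hsq : Summable fun j : J => gg χ (j : 𝓞 K) * (FF s (j + n * b q : 𝓞 K) : ℂ) := by
    refine (summable_equiv_prod e _ hsum q).congr fun j => ?_
    rw [he, gg, hdep, ← gg]
  rw [EE, ← hsq.tsum_sub hsumJ]
  have hbd : ∀ A : Finset J, ∑ j ∈ A, ‖gg χ (j : 𝓞 K) * (FF s (j + n * b q : 𝓞 K) : ℂ) -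
      gg χ (j : 𝓞 K) * (FF s (j : 𝓞 K) : ℂ)‖ ≤ C (n * b q) := by
    intro A
    refine le_trans ?_ (hC (n * b q) s hs hs2 (A.map ⟨_, Subtype.val_injective⟩))
    rw [Finset.sum_map]
    refine Finset.sum_le_sum fun j _ => ?_
    rw [← mul_sub, norm_mul, ← Complex.ofReal_sub, Complex.norm_real, Real.norm_eq_abs]
    exact mul_le_of_le_one_left (abs_nonneg _) (gg_le χ _)
  have hs' := summable_of_sum_le (fun _ => norm_nonneg _) hbd
  exact (norm_tsum_le_tsum_norm hs').trans (hs'.tsum_le_of_sum_le hbd)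

lemma NN_absNorm (a : 𝓞 K) : NN a = (absNorm (span {a}) : ℝ) := by
  rw [NN_eq, absNorm_span_singleton]
  simp

lemma span_unit (u : (𝓞 K)ˣ) (a : 𝓞 K) : span {(u : 𝓞 K) * a} = span {a} :=
  Ideal.span_singleton_mul_left_unit u.isUnit a

abbrev AA (C : ClassGroup (𝓞 K)) := {𝔞 : (Ideal (𝓞 K))⁰ // ClassGroup.mk0 𝔞 = C}

lemma exists_gen (J : (Ideal (𝓞 K))⁰) (𝔞 : AA (ClassGroup.mk0 J)⁻¹) :
    ∃ a : 𝓞 K, a ≠ 0 ∧ ((𝔞 : (Ideal (𝓞 K))⁰) : Ideal (𝓞 K)) * J = span {a} := by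
  have h : ClassGroup.mk0 (𝔞.1 * J) = 1 := by rw [map_mul, 𝔞.2, inv_mul_cancel]
  rw [ClassGroup.mk0_eq_one_iff] at h
  obtain ⟨a, ha⟩ := h
  refine ⟨a, ?_, by simpa using ha⟩
  rintro rfl
  have := nonZeroDivisors.coe_ne_zero (𝔞.1 * J)
  apply this
  simpa using ha

noncomputable def gen (J : (Ideal (𝓞 K))⁰) (𝔞 : AA (ClassGroup.mk0 J)⁻¹) : 𝓞 K :=
  (exists_gen J 𝔞).choose
lemma gen_ne (J : (Ideal (𝓞 K))⁰) (𝔞 : AA (ClassGroup.mk0 J)⁻¹) : gen J 𝔞 ≠ 0 :=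
  (exists_gen J 𝔞).choose_spec.1
lemma gen_span (J : (Ideal (𝓞 K))⁰) (𝔞 : AA (ClassGroup.mk0 J)⁻¹) :
    ((𝔞 : (Ideal (𝓞 K))⁰) : Ideal (𝓞 K)) * J = span {gen J 𝔞} :=
  (exists_gen J 𝔞).choose_spec.2

lemma gen_mem (J : (Ideal (𝓞 K))⁰) (𝔞 : AA (ClassGroup.mk0 J)⁻¹) : gen J 𝔞 ∈ (J : Ideal (𝓞 K)) := by
  have h1 : (J : Ideal (𝓞 K)) ∣ span {gen J 𝔞} := Dvd.intro_left _ (gen_span J 𝔞)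
  exact (span_singleton_le_iff_mem _).mp (Ideal.le_of_dvd h1)

lemma gen_equiv (J : (Ideal (𝓞 K))⁰) : ∃ e : AA (ClassGroup.mk0 J)⁻¹ × (𝓞 K)ˣ ≃
    {a : 𝓞 K // a ∈ (J : Ideal (𝓞 K)) ∧ a ≠ 0},
    ∀ 𝔞 u, (e (𝔞, u) : 𝓞 K) = (u : 𝓞 K) * gen J 𝔞 := by
  refine ⟨Equiv.ofBijective (fun p => ⟨(p.2 : 𝓞 K) * gen J p.1,
    Ideal.mul_mem_left _ _ (gen_mem J p.1), mul_ne_zero p.2.ne_zero (gen_ne J p.1)⟩) ?_,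
    fun _ _ => rfl⟩
  have hJ0 : (J : Ideal (𝓞 K)) ≠ 0 := nonZeroDivisors.coe_ne_zero J
  constructor
  · rintro ⟨𝔞, u⟩ ⟨𝔟, v⟩ h
    have h1 : (u : 𝓞 K) * gen J 𝔞 = v * gen J 𝔟 := congrArg Subtype.val h
    have h2 := congrArg (fun x => span {x}) h1
    simp only [span_unit] at h2
    rw [← gen_span, ← gen_span] at h2
    have h3 : 𝔞 = 𝔟 := Subtype.ext (Subtype.ext (mul_right_cancel₀ hJ0 h2))
    subst h3
    have h4 := mul_right_cancel₀ (gen_ne J 𝔞) h1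
    rw [Units.ext h4]
  · rintro ⟨a, haJ, ha⟩
    obtain ⟨I, hI⟩ := Ideal.dvd_iff_le.mpr ((span_singleton_le_iff_mem _).mpr haJ)
    have hs0 : span {a} ≠ 0 := by simpa using ha
    have hI0 : I ≠ 0 := by rintro rfl; exact hs0 (by rw [hI, mul_zero])
    let 𝔞 : (Ideal (𝓞 K))⁰ := ⟨I, mem_nonZeroDivisors_of_ne_zero hI0⟩
    have hcl : ClassGroup.mk0 𝔞 = (ClassGroup.mk0 J)⁻¹ := by
      rw [eq_inv_iff_mul_eq_one, ← map_mul, ClassGroup.mk0_eq_one_iff]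
      refine ⟨a, ?_⟩
      change I * (J : Ideal (𝓞 K)) = _
      rw [mul_comm, ← hI]
    have hsp : span {gen J ⟨𝔞, hcl⟩} = span {a} := by
      rw [← gen_span, hI, mul_comm]
    obtain ⟨u, hu⟩ := Ideal.span_singleton_eq_span_singleton.mp hsp
    refine ⟨⟨⟨𝔞, hcl⟩, u⟩, Subtype.ext ?_⟩
    exact (mul_comm _ _).trans hu

lemma FF_unit (s : ℝ) (u : (𝓞 K)ˣ) (a : 𝓞 K) : FF s ((u : 𝓞 K) * a) = wt ((u : 𝓞 K) * a) * NN a ^ (-s) := by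
  rw [FF, NN_absNorm, NN_absNorm, span_unit]

lemma gg_unit (χ : DirichletCharacter ℂ n) (u : (𝓞 K)ˣ) (a : 𝓞 K) : gg χ ((u : 𝓞 K) * a) = gg χ a := by
  rw [gg, span_unit, gg]

lemma NN_gen (J : (Ideal (𝓞 K))⁰) (𝔞 : AA (ClassGroup.mk0 J)⁻¹) :
    NN (gen J 𝔞) = absNorm ((𝔞 : (Ideal (𝓞 K))⁰) : Ideal (𝓞 K)) * absNorm (J : Ideal (𝓞 K)) := by
  rw [NN_absNorm, ← gen_span, map_mul]; push_cast; rfl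

noncomputable def tt (s : ℝ) (I : Ideal (𝓞 K)) : ℝ := (absNorm I : ℝ) ^ (-s)

lemma tt_mul (s : ℝ) (I J : Ideal (𝓞 K)) : tt s (I * J) = tt s I * tt s J := by
  rw [tt, map_mul, Nat.cast_mul, Real.mul_rpow (by positivity) (by positivity)]; rfl

lemma tt_nonneg (s : ℝ) (I : Ideal (𝓞 K)) : 0 ≤ tt s I := by unfold tt; positivity

lemma absNorm_pos (I : (Ideal (𝓞 K))⁰) : 0 < absNorm (I : Ideal (𝓞 K)) :=
  Nat.pos_of_ne_zero (by
    rw [Ne, absNorm_eq_zero_iff]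
    exact nonZeroDivisors.coe_ne_zero I)

lemma tt_pos (s : ℝ) (I : (Ideal (𝓞 K))⁰) : 0 < tt s (I : Ideal (𝓞 K)) :=
  Real.rpow_pos_of_pos (by exact_mod_cast absNorm_pos I) _

lemma NN_gen_tt (s : ℝ) (J : (Ideal (𝓞 K))⁰) (𝔞 : AA (ClassGroup.mk0 J)⁻¹) :
    NN (gen J 𝔞) ^ (-s) = tt s ((𝔞 : (Ideal (𝓞 K))⁰) : Ideal (𝓞 K)) * tt s (J : Ideal (𝓞 K)) := by
  rw [NN_absNorm, ← gen_span, ← tt_mul]; rfl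

noncomputable def ZZ (χ : DirichletCharacter ℂ n) (s : ℝ) (C : ClassGroup (𝓞 K)) : ℂ :=
  ∑' 𝔞 : AA C, χ ((absNorm ((𝔞 : (Ideal (𝓞 K))⁰) : Ideal (𝓞 K)) : ℕ) : ZMod n) *
    (tt s ((𝔞 : (Ideal (𝓞 K))⁰) : Ideal (𝓞 K)) : ℂ)

lemma EE_eq (χ : DirichletCharacter ℂ n) {s : ℝ} (hs : 1 < s) (J : (Ideal (𝓞 K))⁰) :
    EE χ s (J : Ideal (𝓞 K)) = torsionOrder K * χ ((absNorm (J : Ideal (𝓞 K)) : ℕ) : ZMod n) *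
      tt s (J : Ideal (𝓞 K)) * ZZ χ s (ClassGroup.mk0 J)⁻¹ := by
  have h0 : EE χ s (J : Ideal (𝓞 K)) = ∑' a : {a : 𝓞 K // a ∈ (J : Ideal (𝓞 K)) ∧ a ≠ 0},
      gg χ (a : 𝓞 K) * (FF s (a : 𝓞 K) : ℂ) := by
    unfold EE
    rw [show (∑' a : (J : Ideal (𝓞 K)), gg χ (a : 𝓞 K) * (FF s (a : 𝓞 K) : ℂ)) =
      ∑' a : ((J : Ideal (𝓞 K)) : Set (𝓞 K)), gg χ (a : 𝓞 K) * (FF s (a : 𝓞 K) : ℂ) from rfl,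
      show (∑' a : {a : 𝓞 K // a ∈ (J : Ideal (𝓞 K)) ∧ a ≠ 0}, gg χ (a : 𝓞 K) * (FF s (a : 𝓞 K) : ℂ)) =
      ∑' a : {a : 𝓞 K | a ∈ (J : Ideal (𝓞 K)) ∧ a ≠ 0}, gg χ (a : 𝓞 K) * (FF s (a : 𝓞 K) : ℂ) from rfl,
      tsum_subtype _ (fun a => gg χ (a : 𝓞 K) * (FF s (a : 𝓞 K) : ℂ)),
      tsum_subtype _ (fun a => gg χ (a : 𝓞 K) * (FF s (a : 𝓞 K) : ℂ))]
    refine tsum_congr fun a => ?_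
    by_cases ha : a = 0
    · subst ha
      simp [Set.indicator, FF_zero (show 0 < s by linarith)]
    · by_cases h : a ∈ (J : Ideal (𝓞 K))
      · rw [Set.indicator_of_mem (show a ∈ ((J : Ideal (𝓞 K)) : Set (𝓞 K)) from h),
          Set.indicator_of_mem (show a ∈ {a : 𝓞 K | a ∈ (J : Ideal (𝓞 K)) ∧ a ≠ 0} from ⟨h, ha⟩)]
      · rw [Set.indicator_of_notMem (show a ∉ ((J : Ideal (𝓞 K)) : Set (𝓞 K)) from h),
          Set.indicator_of_notMem (show a ∉ {a : 𝓞 K | a ∈ (J : Ideal (𝓞 K)) ∧ a ≠ 0} from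
            fun h' => h h'.1)]
  have hS : Summable fun a : {a : 𝓞 K // a ∈ (J : Ideal (𝓞 K)) ∧ a ≠ 0} =>
      gg χ (a : 𝓞 K) * (FF s (a : 𝓞 K) : ℂ) :=
    (gF_summable (K := K) χ hs).comp_injective Subtype.val_injective
  obtain ⟨e, he⟩ := gen_equiv J
  rw [h0, tsum_equiv_prod e _ hS, ZZ, ← tsum_mul_left]
  have h1 : ∀ 𝔞 u, gg χ (e (𝔞, u) : 𝓞 K) * (FF s (e (𝔞, u) : 𝓞 K) : ℂ) =
      (gg χ (gen J 𝔞) * (NN (gen J 𝔞) ^ (-s) : ℝ)) * (wt ((u : 𝓞 K) * gen J 𝔞) : ℂ) := by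
    intro 𝔞 u
    rw [he, gg_unit, FF_unit]
    push_cast
    ring
  simp only [h1]
  refine tsum_congr fun 𝔞 => ?_
  have h2 := (wt_hasSum (gen_ne J 𝔞))
  have h3 : HasSum (fun u : (𝓞 K)ˣ => (wt ((u : 𝓞 K) * gen J 𝔞) : ℂ)) (torsionOrder K : ℂ) := by
    exact_mod_cast h2.mapL Complex.ofRealCLM
  rw [tsum_mul_left, h3.tsum_eq, NN_gen_tt, gg, ← gen_span, map_mul]
  push_cast
  rw [map_mul]
  ring

lemma tt_summable_class {s : ℝ} (hs : 1 < s) (C : ClassGroup (𝓞 K)) :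
    Summable fun 𝔞 : AA C => tt s ((𝔞 : (Ideal (𝓞 K))⁰) : Ideal (𝓞 K)) := by
  obtain ⟨J, hJ⟩ := ClassGroup.mk0_surjective C⁻¹
  obtain rfl : C = (ClassGroup.mk0 J)⁻¹ := by rw [hJ, inv_inv]
  have hS : Summable fun a : {a : 𝓞 K // a ∈ (J : Ideal (𝓞 K)) ∧ a ≠ 0} => FF s (a : 𝓞 K) :=
    (FF_summable (K := K) hs).comp_injective Subtype.val_injective
  obtain ⟨e, he⟩ := gen_equiv J
  have hS1 : Summable fun p => FF s (e p : 𝓞 K) := e.summable_iff.mpr hS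
  have hS2 := hS1.prod
  have ht : (torsionOrder K : ℝ) ≠ 0 := by exact_mod_cast torsionOrder_ne_zero K
  refine (summable_mul_right_iff (mul_ne_zero ht (tt_pos s J).ne')).mp (hS2.congr fun 𝔞 => ?_)
  have h1 : ∀ u, FF s (e (𝔞, u) : 𝓞 K) = wt ((u : 𝓞 K) * gen J 𝔞) * NN (gen J 𝔞) ^ (-s) := by
    intro u
    rw [he, FF_unit]
  simp only [h1]
  rw [tsum_mul_right, (wt_hasSum (gen_ne J 𝔞)).tsum_eq, NN_gen_tt]
  ring
end Bdd

section Bdd2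
open NumberField.Units Module Ideal

variable {K : Type*} [Field K] [NumberField K] {n : ℕ} [NeZero n]

lemma tt_summable {s : ℝ} (hs : 1 < s) :
    Summable fun 𝔞 : (Ideal (𝓞 K))⁰ => tt s (𝔞 : Ideal (𝓞 K)) := by
  let e := Equiv.sigmaFiberEquiv (fun 𝔞 : (Ideal (𝓞 K))⁰ => ClassGroup.mk0 𝔞)
  rw [← e.summable_iff]
  refine (summable_sigma_of_nonneg (fun p => tt_nonneg s (e p : Ideal (𝓞 K)))).mpr ?_
  refine ⟨fun C => tt_summable_class hs C, ?_⟩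
  exact Summable.of_finite

noncomputable def fch (χ : DirichletCharacter ℂ n) (ψ : ClassGroup (𝓞 K) →* ℂˣ) :
    (Ideal (𝓞 K))⁰ →* ℂ where
  toFun 𝔞 := (ψ (ClassGroup.mk0 𝔞) : ℂ) * χ ((absNorm (𝔞 : Ideal (𝓞 K)) : ℕ) : ZMod n)
  map_one' := by simp
  map_mul' a b := by simp; ring

lemma psi_norm (ψ : ClassGroup (𝓞 K) →* ℂˣ) (x : ClassGroup (𝓞 K)) : ‖(ψ x : ℂ)‖ = 1 := by
  have h : (ψ x : ℂ) ^ (Fintype.card (ClassGroup (𝓞 K))) = 1 := by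
    rw [← Units.val_pow_eq_pow_val, ← map_pow, pow_card_eq_one, map_one, Units.val_one]
  exact Complex.norm_eq_one_of_pow_eq_one h Fintype.card_ne_zero

lemma fch_le (χ : DirichletCharacter ℂ n) (ψ : ClassGroup (𝓞 K) →* ℂˣ) (𝔞 : (Ideal (𝓞 K))⁰) :
    ‖fch χ ψ 𝔞‖ ≤ 1 := by
  simp only [fch, MonoidHom.coe_mk, OneHom.coe_mk]
  rw [norm_mul, psi_norm, one_mul]
  exact χ.norm_le_one _

noncomputable def LL (χ : DirichletCharacter ℂ n) (ψ : ClassGroup (𝓞 K) →* ℂˣ) (s : ℝ) : ℂ :=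
  ∑' 𝔞 : (Ideal (𝓞 K))⁰, fch χ ψ 𝔞 * (tt s (𝔞 : Ideal (𝓞 K)) : ℂ)

lemma LL_summable (χ : DirichletCharacter ℂ n) (ψ : ClassGroup (𝓞 K) →* ℂˣ) {s : ℝ} (hs : 1 < s) :
    Summable fun 𝔞 : (Ideal (𝓞 K))⁰ => fch χ ψ 𝔞 * (tt s (𝔞 : Ideal (𝓞 K)) : ℂ) := by
  refine Summable.of_norm_bounded (tt_summable hs) fun a => ?_
  rw [norm_mul, Complex.norm_real, Real.norm_of_nonneg (tt_nonneg s _)]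
  exact mul_le_of_le_one_left (tt_nonneg s _) (fch_le χ ψ a)

lemma LL_eq (χ : DirichletCharacter ℂ n) (ψ : ClassGroup (𝓞 K) →* ℂˣ) {s : ℝ} (hs : 1 < s) :
    LL χ ψ s = ∑ C : ClassGroup (𝓞 K), (ψ C : ℂ) * ZZ χ s C := by
  let e := Equiv.sigmaFiberEquiv (fun 𝔞 : (Ideal (𝓞 K))⁰ => ClassGroup.mk0 𝔞)
  have h := LL_summable χ ψ hs
  have h2 : Summable fun p => fch χ ψ (e p) * (tt s (e p : Ideal (𝓞 K)) : ℂ) := e.summable_iff.mpr h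
  rw [LL, ← e.tsum_eq, h2.tsum_sigma, tsum_fintype]
  refine Finset.sum_congr rfl fun C _ => ?_
  rw [ZZ, ← tsum_mul_left]
  refine tsum_congr fun 𝔞 => ?_
  have : e ⟨C, 𝔞⟩ = 𝔞.1 := rfl
  rw [this]
  simp only [fch, MonoidHom.coe_mk, OneHom.coe_mk]
  rw [𝔞.2, mul_assoc]

lemma exists_coprime_rep (n : ℕ) [NeZero n] (C : ClassGroup (𝓞 K)) :
    ∃ J : (Ideal (𝓞 K))⁰, ClassGroup.mk0 J = C ∧ (J : Ideal (𝓞 K)) ⊔ span {(n : 𝓞 K)} = ⊤ := by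
  obtain ⟨I, hI⟩ := ClassGroup.mk0_surjective C⁻¹
  have hI0 : (I : Ideal (𝓞 K)) ≠ 0 := nonZeroDivisors.coe_ne_zero I
  have hn0 : span {(n : 𝓞 K)} ≠ 0 := by
    simp only [ne_eq, zero_eq_bot, span_singleton_eq_bot, Nat.cast_eq_zero]
    exact NeZero.ne n
  obtain ⟨a, ha⟩ := IsDedekindDomain.exists_sup_span_eq (I := (I : Ideal (𝓞 K)) * span {(n : 𝓞 K)})
    (J := (I : Ideal (𝓞 K))) (Ideal.le_of_dvd (Dvd.intro _ rfl)) (mul_ne_zero hI0 hn0)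
  by_cases ha0 : a = 0
  · obtain ⟨J, hJ⟩ := ClassGroup.mk0_surjective C
    refine ⟨J, hJ, ?_⟩
    rw [ha0, span_singleton_zero, sup_bot_eq] at ha
    have h1 : span {(n : 𝓞 K)} = 1 := mul_left_cancel₀ hI0 (by rw [ha, mul_one])
    rw [h1, one_eq_top, sup_top_eq]
  · have haI : span {a} ≤ (I : Ideal (𝓞 K)) := le_sup_right.trans ha.le
    obtain ⟨J, hJ⟩ := Ideal.dvd_iff_le.mpr haI
    have hs0 : span {a} ≠ 0 := by simpa using ha0
    have hJ0 : J ≠ 0 := by rintro rfl; exact hs0 (by rw [hJ, mul_zero])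
    refine ⟨⟨J, mem_nonZeroDivisors_of_ne_zero hJ0⟩, ?_, ?_⟩
    · rw [← inv_inv C, ← hI, eq_inv_iff_mul_eq_one, ← map_mul, ClassGroup.mk0_eq_one_iff]
      refine ⟨a, ?_⟩
      change J * (I : Ideal (𝓞 K)) = _
      rw [mul_comm, ← hJ]
    · change J ⊔ span {(n : 𝓞 K)} = ⊤
      rw [hJ, ← Ideal.mul_sup] at ha
      rw [sup_comm, ← one_eq_top]
      exact mul_left_cancel₀ hI0 (by rw [ha, mul_one])

lemma absNorm_coprime (J : (Ideal (𝓞 K))⁰) (h : (J : Ideal (𝓞 K)) ⊔ span {(n : 𝓞 K)} = ⊤) :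
    Nat.Coprime (absNorm (J : Ideal (𝓞 K))) n := by
  by_contra hc
  obtain ⟨p, hp, h1, h2⟩ := Nat.Prime.not_coprime_iff_dvd.mp hc
  have := Fact.mk hp
  have : Finite (𝓞 K ⧸ (J : Ideal (𝓞 K))) := Ideal.finiteQuotientOfFreeOfNeBot _ (nonZeroDivisors.coe_ne_zero J)
  have : Fintype (𝓞 K ⧸ (J : Ideal (𝓞 K))) := Fintype.ofFinite _
  rw [absNorm_apply, Submodule.cardQuot_apply, Nat.card_eq_fintype_card] at h1
  obtain ⟨x, hx⟩ := exists_prime_addOrderOf_dvd_card p h1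
  obtain ⟨x', rfl⟩ := Ideal.Quotient.mk_surjective x
  have hnx : n • (Ideal.Quotient.mk (J : Ideal (𝓞 K)) x') = 0 := by
    obtain ⟨k, rfl⟩ := h2
    rw [mul_comm, mul_smul, ← hx, addOrderOf_nsmul_eq_zero, smul_zero]
  have hx0 : Ideal.Quotient.mk (J : Ideal (𝓞 K)) x' = 0 := by
    have : (1 : 𝓞 K) ∈ (J : Ideal (𝓞 K)) ⊔ span {(n : 𝓞 K)} := h ▸ Submodule.mem_top
    obtain ⟨y, hy, z, hz, hyz⟩ := Submodule.mem_sup.mp this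
    obtain ⟨w, rfl⟩ := mem_span_singleton'.mp hz
    have h3 : x' = y * x' + w * (n * x') := by linear_combination (-x') * hyz
    rw [h3, map_add, map_mul, map_mul, map_mul, Ideal.Quotient.eq_zero_iff_mem.mpr hy, map_natCast,
      ← nsmul_eq_mul, hnx]
    simp
  rw [hx0, addOrderOf_zero] at hx
  exact hp.one_lt.ne hx

lemma chi_norm (χ : DirichletCharacter ℂ n) (J : (Ideal (𝓞 K))⁰)
    (h : (J : Ideal (𝓞 K)) ⊔ span {(n : 𝓞 K)} = ⊤) :
    ‖χ ((absNorm (J : Ideal (𝓞 K)) : ℕ) : ZMod n)‖ = 1 := by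
  have hu := (ZMod.isUnit_iff_coprime _ n).mpr (absNorm_coprime J h)
  obtain ⟨u, hu⟩ := hu
  rw [← hu]
  exact DirichletCharacter.unit_norm_eq_one χ u

lemma ZZ_shift (χ : DirichletCharacter ℂ n)
    (hdep : ∀ a b : 𝓞 K, ((absNorm (span {a + n * b}) : ℕ) : ZMod n) = (absNorm (span {a}) : ℕ))
    (𝔠 : (Ideal (𝓞 K))⁰) (h𝔠 : (𝔠 : Ideal (𝓞 K)) ⊔ span {(n : 𝓞 K)} = ⊤) (C : ClassGroup (𝓞 K)) :
    ∃ D : ℝ, ∀ s : ℝ, 1 < s → s ≤ 2 → ‖ZZ χ s C⁻¹ - absNorm (𝔠 : Ideal (𝓞 K)) *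
      χ ((absNorm (𝔠 : Ideal (𝓞 K)) : ℕ) : ZMod n) * tt s (𝔠 : Ideal (𝓞 K)) *
      ZZ χ s (C⁻¹ * (ClassGroup.mk0 𝔠)⁻¹)‖ ≤ D := by
  obtain ⟨J, hJ, hJn⟩ := exists_coprime_rep n C
  have hprod : ((J * 𝔠 : (Ideal (𝓞 K))⁰) : Ideal (𝓞 K)) ⊔ span {(n : 𝓞 K)} = ⊤ := by
    change (J : Ideal (𝓞 K)) * 𝔠 ⊔ span {(n : 𝓞 K)} = ⊤
    rw [← Ideal.isCoprime_iff_sup_eq] at *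
    exact IsCoprime.mul_left hJn h𝔠
  obtain ⟨C1, h1⟩ := EE_shift χ hdep J (nonZeroDivisors.coe_ne_zero J) hJn
  obtain ⟨C2, h2⟩ := EE_shift χ hdep (J * 𝔠 : (Ideal (𝓞 K))⁰) (nonZeroDivisors.coe_ne_zero _) hprod
  refine ⟨(C1 + C2) * absNorm (J : Ideal (𝓞 K)), fun s hs hs2 => ?_⟩
  have h1 := h1 s hs hs2
  have h2 := h2 s hs hs2
  rw [EE_eq χ hs] at h1 h2
  have h3 := norm_sub_le_of_le h2 h1
  rw [sub_sub_sub_cancel_left] at h3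
  have hN : (1 : ℝ) ≤ absNorm (J : Ideal (𝓞 K)) := by exact_mod_cast absNorm_pos J
  have ht : (1 : ℝ) ≤ torsionOrder K := by
    exact_mod_cast Nat.one_le_iff_ne_zero.mpr (torsionOrder_ne_zero K)
  have hfac : (absNorm (J : Ideal (𝓞 K)) : ℂ) * (torsionOrder K * χ ((absNorm (J : Ideal (𝓞 K)) : ℕ) : ZMod n) *
      tt s (J : Ideal (𝓞 K)) * ZZ χ s (ClassGroup.mk0 J)⁻¹) -
      (absNorm ((J * 𝔠 : (Ideal (𝓞 K))⁰) : Ideal (𝓞 K)) : ℂ) * (torsionOrder K *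
      χ ((absNorm ((J * 𝔠 : (Ideal (𝓞 K))⁰) : Ideal (𝓞 K)) : ℕ) : ZMod n) *
      tt s ((J * 𝔠 : (Ideal (𝓞 K))⁰) : Ideal (𝓞 K)) * ZZ χ s (ClassGroup.mk0 (J * 𝔠))⁻¹) =
      (torsionOrder K * χ ((absNorm (J : Ideal (𝓞 K)) : ℕ) : ZMod n) *
        (absNorm (J : Ideal (𝓞 K)) * tt s (J : Ideal (𝓞 K)) : ℝ)) *
      (ZZ χ s C⁻¹ - absNorm (𝔠 : Ideal (𝓞 K)) *
      χ ((absNorm (𝔠 : Ideal (𝓞 K)) : ℕ) : ZMod n) * tt s (𝔠 : Ideal (𝓞 K)) *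
      ZZ χ s (C⁻¹ * (ClassGroup.mk0 𝔠)⁻¹)) := by
    rw [map_mul, hJ, mul_inv, Submonoid.coe_mul, tt_mul, map_mul]
    push_cast
    rw [map_mul]
    ring
  rw [hfac, norm_mul, norm_mul, norm_mul, chi_norm χ J hJn, Complex.norm_natCast, Complex.norm_real,
    mul_one, Real.norm_of_nonneg (mul_nonneg (by positivity) (tt_nonneg _ _))] at h3
  have hlow : (absNorm (J : Ideal (𝓞 K)) : ℝ)⁻¹ ≤ absNorm (J : Ideal (𝓞 K)) * tt s (J : Ideal (𝓞 K)) := by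
    rw [tt]
    nth_rewrite 2 [← Real.rpow_one (absNorm (J : Ideal (𝓞 K)) : ℝ)]
    rw [← Real.rpow_add (by linarith), ← Real.rpow_neg_one]
    exact Real.rpow_le_rpow_of_exponent_le hN (by linarith)
  have hX : 0 ≤ ‖ZZ χ s C⁻¹ - absNorm (𝔠 : Ideal (𝓞 K)) *
      χ ((absNorm (𝔠 : Ideal (𝓞 K)) : ℕ) : ZMod n) * tt s (𝔠 : Ideal (𝓞 K)) *
      ZZ χ s (C⁻¹ * (ClassGroup.mk0 𝔠)⁻¹)‖ := norm_nonneg _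
  generalize ‖ZZ χ s C⁻¹ - absNorm (𝔠 : Ideal (𝓞 K)) *
      χ ((absNorm (𝔠 : Ideal (𝓞 K)) : ℕ) : ZMod n) * tt s (𝔠 : Ideal (𝓞 K)) *
      ZZ χ s (C⁻¹ * (ClassGroup.mk0 𝔠)⁻¹)‖ = X at h3 hX ⊢
  generalize (absNorm (J : Ideal (𝓞 K)) : ℝ) * tt s (J : Ideal (𝓞 K)) = y at h3 hlow
  generalize (absNorm (J : Ideal (𝓞 K)) : ℝ) = N at h3 hlow hN ⊢
  generalize (torsionOrder K : ℝ) = t at h3 ht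
  have hN0 : 0 < N := by linarith
  have hNi : 0 < N⁻¹ := inv_pos.mpr hN0
  calc X = N * (1 * N⁻¹ * X) := by field_simp
    _ ≤ N * (t * y * X) := by gcongr
    _ ≤ N * (C1 + C2) := by gcongr; linarith
    _ = _ := mul_comm _ _

lemma LL_bdd (χ : DirichletCharacter ℂ n) (ψ : ClassGroup (𝓞 K) →* ℂˣ)
    (hdep : ∀ a b : 𝓞 K, ((absNorm (span {a + n * b}) : ℕ) : ZMod n) = (absNorm (span {a}) : ℕ))
    (𝔠 : (Ideal (𝓞 K))⁰) (h𝔠 : (𝔠 : Ideal (𝓞 K)) ⊔ span {(n : 𝓞 K)} = ⊤)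
    (hf : fch χ ψ 𝔠 ≠ 1) :
    ∃ B : ℝ, ∀ᶠ s in nhdsWithin (1 : ℝ) (Set.Ioi 1), ‖LL χ ψ s‖ ≤ B := by
  choose D hD using fun C => ZZ_shift χ hdep 𝔠 h𝔠 C
  have hmain : ∀ s : ℝ, 1 < s → s ≤ 2 → ‖(1 - fch χ ψ 𝔠 * ((absNorm (𝔠 : Ideal (𝓞 K)) * tt s (𝔠 : Ideal (𝓞 K)) : ℝ) : ℂ)) * LL χ ψ s‖ ≤ ∑ C, D C := by
    intro s hs hs2
    have e1 : LL χ ψ s = ∑ C : ClassGroup (𝓞 K), (ψ C⁻¹ : ℂ) * ZZ χ s C⁻¹ := by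
      rw [LL_eq χ ψ hs]
      exact (Equiv.sum_comp (Equiv.inv (ClassGroup (𝓞 K))) (fun C => (ψ C : ℂ) * ZZ χ s C)).symm
    have e2 : LL χ ψ s = ∑ C : ClassGroup (𝓞 K), (ψ (C⁻¹ * (ClassGroup.mk0 𝔠)⁻¹) : ℂ) *
        ZZ χ s (C⁻¹ * (ClassGroup.mk0 𝔠)⁻¹) := by
      rw [LL_eq χ ψ hs]
      exact (Equiv.sum_comp ((Equiv.inv (ClassGroup (𝓞 K))).trans (Equiv.mulRight (ClassGroup.mk0 𝔠)⁻¹))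
        (fun C => (ψ C : ℂ) * ZZ χ s C)).symm
    rw [sub_mul, one_mul]
    nth_rewrite 1 [e1]
    rw [e2, Finset.mul_sum, ← Finset.sum_sub_distrib]
    refine (norm_sum_le _ _).trans (Finset.sum_le_sum fun C _ => ?_)
    refine le_trans (le_of_eq ?_) (hD C s hs hs2)
    rw [← one_mul (‖ZZ χ s C⁻¹ - _‖), ← psi_norm ψ C⁻¹, ← norm_mul]
    congr 1
    simp only [fch, MonoidHom.coe_mk, OneHom.coe_mk, map_mul, map_inv, Units.val_mul]
    push_cast
    have : (ψ (ClassGroup.mk0 𝔠) : ℂ) ≠ 0 := Units.ne_zero _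
    field_simp
  have hN : (0 : ℝ) < absNorm (𝔠 : Ideal (𝓞 K)) := by exact_mod_cast absNorm_pos 𝔠
  have hcont : Filter.Tendsto (fun s : ℝ => ‖1 - fch χ ψ 𝔠 * ((absNorm (𝔠 : Ideal (𝓞 K)) * tt s (𝔠 : Ideal (𝓞 K)) : ℝ) : ℂ)‖)
      (nhdsWithin (1 : ℝ) (Set.Ioi 1)) (nhds ‖1 - fch χ ψ 𝔠‖) := by
    have hc : Continuous (fun s : ℝ => ‖1 - fch χ ψ 𝔠 * ((absNorm (𝔠 : Ideal (𝓞 K)) * tt s (𝔠 : Ideal (𝓞 K)) : ℝ) : ℂ)‖) := by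
      unfold tt
      have : Continuous fun s : ℝ => (absNorm (𝔠 : Ideal (𝓞 K)) : ℝ) ^ (-s) :=
        (Real.continuous_const_rpow hN.ne').comp continuous_neg
      fun_prop
    have h := hc.tendsto 1
    have hv : ‖1 - fch χ ψ 𝔠 * ((absNorm (𝔠 : Ideal (𝓞 K)) * tt 1 (𝔠 : Ideal (𝓞 K)) : ℝ) : ℂ)‖ = ‖1 - fch χ ψ 𝔠‖ := by
      rw [tt, Real.rpow_neg_one, mul_inv_cancel₀ hN.ne']; simp
    simp only [hv] at h
    exact h.mono_left nhdsWithin_le_nhds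
  have hpos : 0 < ‖1 - fch χ ψ 𝔠‖ := norm_pos_iff.mpr (sub_ne_zero.mpr (Ne.symm hf))
  have hev := hcont.eventually (lt_mem_nhds (half_lt_self hpos))
  refine ⟨(∑ C, D C) / (‖1 - fch χ ψ 𝔠‖ / 2), ?_⟩
  filter_upwards [hev, Ioc_mem_nhdsGT (show (1 : ℝ) < 2 by norm_num)] with s hs hs2
  rw [le_div_iff₀ (by linarith)]
  have := hmain s hs2.1 hs2.2
  rw [norm_mul] at this
  refine le_trans ?_ this
  rw [mul_comm]
  gcongr
end Bdd2

section Euler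
open Ideal

variable {R : Type*} [CommRing R] [IsDedekindDomain R]

def TS (S : Finset (Ideal R)⁰) : Set (Ideal R)⁰ := {𝔞 | ∀ 𝔮 ∈ S, ¬ (𝔮 : Ideal R) ∣ (𝔞 : Ideal R)}

lemma euler_step (F : (Ideal R)⁰ →* ℂ) (hF : Summable F) (S : Finset (Ideal R)⁰)
    (hS : ∀ 𝔮 ∈ S, Prime (𝔮 : Ideal R)) (𝔮 : (Ideal R)⁰) (h𝔮 : Prime (𝔮 : Ideal R)) (hn : 𝔮 ∉ S) [DecidableEq (Ideal R)⁰] :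
    ∑' 𝔞, (TS (insert 𝔮 S)).indicator F 𝔞 = (1 - F 𝔮) * ∑' 𝔞, (TS S).indicator F 𝔞 := by
  have key : ∀ 𝔞 : (Ideal R)⁰, 𝔮 * 𝔞 ∈ TS S ↔ 𝔞 ∈ TS S := by
    intro 𝔞
    refine forall₂_congr fun p hp => not_congr ⟨fun h => ?_, fun h => ?_⟩
    · rcases (hS p hp).dvd_or_dvd (show (p : Ideal R) ∣ (𝔮 : Ideal R) * (𝔞 : Ideal R) from h) with h1 | h1
      · have := (hS p hp).associated_of_dvd h𝔮 h1
        rw [associated_iff_eq] at this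
        exact absurd (Subtype.ext this ▸ hp) hn
      · exact h1
    · exact h.mul_left _
  set A : Set (Ideal R)⁰ := {𝔞 | 𝔞 ∈ TS S ∧ (𝔮 : Ideal R) ∣ (𝔞 : Ideal R)} with hA
  have h1 : ∀ 𝔞, (TS S).indicator F 𝔞 = (TS (insert 𝔮 S)).indicator F 𝔞 + A.indicator F 𝔞 := by
    intro 𝔞
    by_cases ha : 𝔞 ∈ TS S
    · by_cases hb : (𝔮 : Ideal R) ∣ (𝔞 : Ideal R)
      · have h2 : 𝔞 ∉ TS (insert 𝔮 S) := fun h => h 𝔮 (Finset.mem_insert_self _ _) hb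
        rw [Set.indicator_of_mem ha, Set.indicator_of_notMem h2, Set.indicator_of_mem (show 𝔞 ∈ A from ⟨ha, hb⟩), zero_add]
      · have h2 : 𝔞 ∈ TS (insert 𝔮 S) := by
          intro p hp
          rcases Finset.mem_insert.mp hp with rfl | hp
          · exact hb
          · exact ha p hp
        rw [Set.indicator_of_mem ha, Set.indicator_of_mem h2, Set.indicator_of_notMem (show 𝔞 ∉ A from fun h => hb h.2), add_zero]
    · have h2 : 𝔞 ∉ TS (insert 𝔮 S) := fun h => ha fun p hp => h p (Finset.mem_insert_of_mem hp)
      rw [Set.indicator_of_notMem ha, Set.indicator_of_notMem h2, Set.indicator_of_notMem (show 𝔞 ∉ A from fun h => ha h.1), zero_add]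
  have h2 : ∑' 𝔞, A.indicator F 𝔞 = F 𝔮 * ∑' 𝔞, (TS S).indicator F 𝔞 := by
    have hinj : Function.Injective (fun 𝔞 : (Ideal R)⁰ => 𝔮 * 𝔞) := by
      intro a b hab
      have := congrArg Subtype.val hab
      exact Subtype.ext (mul_left_cancel₀ h𝔮.ne_zero this)
    rw [← hinj.tsum_eq, ← tsum_mul_left]
    · refine tsum_congr fun 𝔞 => ?_
      by_cases ha : 𝔞 ∈ TS S
      · rw [Set.indicator_of_mem ha, Set.indicator_of_mem (show 𝔮 * 𝔞 ∈ A from ⟨(key 𝔞).mpr ha, Dvd.intro _ rfl⟩), map_mul]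
      · rw [Set.indicator_of_notMem ha, Set.indicator_of_notMem (show 𝔮 * 𝔞 ∉ A from fun h => ha ((key 𝔞).mp h.1)), mul_zero]
    · intro 𝔞 ha
      have ha' : 𝔞 ∈ A := by
        by_contra h
        exact ha (Set.indicator_of_notMem h _)
      obtain ⟨c, hc⟩ := ha'.2
      have hc0 : c ≠ 0 := by
        rintro rfl
        rw [mul_zero] at hc
        exact nonZeroDivisors.coe_ne_zero 𝔞 hc
      exact ⟨⟨c, mem_nonZeroDivisors_of_ne_zero hc0⟩, Subtype.ext hc.symm⟩
  have h3 := (hF.indicator (TS (insert 𝔮 S))).tsum_add (hF.indicator A)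
  rw [← tsum_congr h1, h2] at h3
  linear_combination -h3

lemma euler_prod (F : (Ideal R)⁰ →* ℂ) (hF : Summable F) (S : Finset (Ideal R)⁰)
    (hS : ∀ 𝔮 ∈ S, Prime (𝔮 : Ideal R)) :
    ∑' 𝔞, (TS S).indicator F 𝔞 = (∏ 𝔮 ∈ S, (1 - F 𝔮)) * ∑' 𝔞, F 𝔞 := by
  classical
  induction S using Finset.induction_on with
  | empty => simp [TS, Set.indicator]
  | insert 𝔮 S hn ih =>
    rw [euler_step F hF S (fun p hp => hS p (Finset.mem_insert_of_mem hp)) 𝔮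
      (hS 𝔮 (Finset.mem_insert_self _ _)) hn, Finset.prod_insert hn,
      ih (fun p hp => hS p (Finset.mem_insert_of_mem hp)), mul_assoc]

lemma exists_prime_factor (𝔞 : (Ideal R)⁰) (h : 𝔞 ≠ 1) :
    ∃ 𝔮 : (Ideal R)⁰, Prime (𝔮 : Ideal R) ∧ (𝔮 : Ideal R) ∣ (𝔞 : Ideal R) := by
  have h1 : ¬ IsUnit (𝔞 : Ideal R) := by
    rw [Ideal.isUnit_iff]
    intro h2
    exact h (Subtype.ext (h2.trans one_eq_top.symm))
  obtain ⟨p, hp, hpd⟩ := WfDvdMonoid.exists_irreducible_factor h1 (nonZeroDivisors.coe_ne_zero 𝔞)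
  exact ⟨⟨p, mem_nonZeroDivisors_of_ne_zero hp.ne_zero⟩, hp.prime, hpd⟩

lemma euler_half (F : (Ideal R)⁰ →* ℂ) (hF : Summable fun 𝔞 => ‖F 𝔞‖) :
    ∃ S₀ : Finset (Ideal R)⁰, (∀ 𝔮 ∈ S₀, Prime (𝔮 : Ideal R)) ∧ ∀ S : Finset (Ideal R)⁰,
    S₀ ⊆ S → (∀ 𝔮 ∈ S, Prime (𝔮 : Ideal R)) →
    1 / 2 ≤ (∏ 𝔮 ∈ S, ‖1 - F 𝔮‖) * ‖∑' 𝔞, F 𝔞‖ := by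
  classical
  have hev := hF.tsum_vanishing (Metric.ball_mem_nhds (0 : ℝ) (show (0 : ℝ) < 1 / 2 by norm_num))
  obtain ⟨A, hA⟩ := hev
  choose! pf hpf1 hpf2 using exists_prime_factor (R := R)
  refine ⟨(A.erase 1).image pf, ?_, fun S hS hp => ?_⟩
  · intro 𝔮 h
    obtain ⟨a, ha, rfl⟩ := Finset.mem_image.mp h
    exact hpf1 a (Finset.ne_of_mem_erase ha)
  have h1 := euler_prod F hF.of_norm S hp
  have h2 : ∑' 𝔞, (TS S).indicator F 𝔞 = 1 + ∑' 𝔞, (TS S \ {1}).indicator F 𝔞 := by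
    have hm : (1 : (Ideal R)⁰) ∈ TS S := by
      intro p hps hd
      exact (hp p hps).not_unit (isUnit_of_dvd_one hd)
    rw [(hF.of_norm.indicator (TS S)).tsum_eq_add_tsum_ite 1, Set.indicator_of_mem hm, map_one]
    congr 1
    refine tsum_congr fun 𝔞 => ?_
    by_cases h : 𝔞 = 1
    · simp [h]
    · simp [Set.indicator, h]
  have h3 : ‖∑' 𝔞, (TS S \ {1}).indicator F 𝔞‖ ≤ 1 / 2 := by
    have hdisj : Disjoint (TS S \ {1}) (A : Set (Ideal R)⁰) := by
      rw [Set.disjoint_left]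
      rintro a ⟨ha, ha1⟩ haA
      exact ha (pf a) (hS (Finset.mem_image_of_mem _ (Finset.mem_erase.mpr ⟨ha1, haA⟩))) (hpf2 a ha1)
    have h4 := hA _ hdisj
    rw [mem_ball_zero_iff] at h4
    rw [← tsum_subtype]
    refine (norm_tsum_le_tsum_norm (hF.comp_injective Subtype.val_injective)).trans ?_
    exact (le_abs_self _).trans h4.le
  have h4 : 1 / 2 ≤ ‖∑' 𝔞, (TS S).indicator F 𝔞‖ := by
    rw [h2]
    have := norm_sub_le_norm_add (1 : ℂ) (∑' 𝔞, (TS S \ {1}).indicator F 𝔞)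
    rw [norm_one] at this
    linarith
  rw [h1, norm_mul, norm_prod] at h4
  exact h4

lemma norm_one_sub_le (z : ℂ) : ‖1 - z‖ ≤ Real.exp (- z.re + ‖z‖ ^ 2 / 2) := by
  have h1 : ‖1 - z‖ ^ 2 ≤ Real.exp (- z.re + ‖z‖ ^ 2 / 2) ^ 2 := by
    rw [← Real.exp_nat_mul, Complex.sq_norm, Complex.sq_norm, Complex.normSq_apply, Complex.normSq_apply]
    refine le_trans (le_of_eq ?_) (Real.add_one_le_exp _)
    simp
    ring
  exact le_of_sq_le_sq h1 (Real.exp_pos _).le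

lemma euler_bound (F : (Ideal R)⁰ →* ℂ) (hF : Summable fun 𝔞 => ‖F 𝔞‖) (B T : ℝ)
    (hB : ‖∑' 𝔞, F 𝔞‖ ≤ B) (hT : ∀ S : Finset (Ideal R)⁰, ∑ 𝔮 ∈ S, ‖F 𝔮‖ ^ 2 ≤ T) :
    ∃ S₀ : Finset (Ideal R)⁰, (∀ 𝔮 ∈ S₀, Prime (𝔮 : Ideal R)) ∧ ∀ S : Finset (Ideal R)⁰,
    S₀ ⊆ S → (∀ 𝔮 ∈ S, Prime (𝔮 : Ideal R)) →
    ∑ 𝔮 ∈ S, (F 𝔮).re ≤ Real.log (2 * B) + T / 2 := by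
  obtain ⟨S₀, h0, h⟩ := euler_half F hF
  refine ⟨S₀, h0, fun S hS hp => ?_⟩
  have h1 := h S hS hp
  have h2 : ∏ 𝔮 ∈ S, ‖1 - F 𝔮‖ ≤ Real.exp (- ∑ 𝔮 ∈ S, (F 𝔮).re + T / 2) := by
    calc _ ≤ ∏ 𝔮 ∈ S, Real.exp (- (F 𝔮).re + ‖F 𝔮‖ ^ 2 / 2) :=
          Finset.prod_le_prod (fun _ _ => norm_nonneg _) (fun _ _ => norm_one_sub_le _)
      _ = Real.exp (∑ 𝔮 ∈ S, (- (F 𝔮).re + ‖F 𝔮‖ ^ 2 / 2)) := (Real.exp_sum _ _).symm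
      _ ≤ _ := by
        apply Real.exp_le_exp.mpr
        rw [Finset.sum_add_distrib, Finset.sum_neg_distrib, ← Finset.sum_div]
        linarith [hT S]
  have h3 : 1 / 2 ≤ Real.exp (- ∑ 𝔮 ∈ S, (F 𝔮).re + T / 2) * B :=
    h1.trans (mul_le_mul h2 hB (norm_nonneg _) (Real.exp_pos _).le)
  have hB0 : 0 < B := by
    by_contra hc
    push Not at hc
    have := mul_nonpos_of_nonneg_of_nonpos (Real.exp_pos (- ∑ 𝔮 ∈ S, (F 𝔮).re + T / 2)).le hc
    linarith
  have h4 : Real.exp (∑ 𝔮 ∈ S, (F 𝔮).re - T / 2) ≤ 2 * B := by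
    have h5 : Real.exp (∑ 𝔮 ∈ S, (F 𝔮).re - T / 2) * Real.exp (- ∑ 𝔮 ∈ S, (F 𝔮).re + T / 2) = 1 := by
      rw [← Real.exp_add]; simp
    have := mul_le_mul_of_nonneg_left h3 (Real.exp_pos (∑ 𝔮 ∈ S, (F 𝔮).re - T / 2)).le
    rw [← mul_assoc, h5] at this
    linarith
  have h6 := (Real.le_log_iff_exp_le (by linarith)).mpr h4
  linarith
end Euler

section Comb
open Module Ideal

variable {K : Type*} [Field K] [NumberField K] {n : ℕ} [NeZero n]

noncomputable def FM (χ : DirichletCharacter ℂ n) (ψ : ClassGroup (𝓞 K) →* ℂˣ) (s : ℝ) :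
    (Ideal (𝓞 K))⁰ →* ℂ where
  toFun 𝔞 := fch χ ψ 𝔞 * (tt s (𝔞 : Ideal (𝓞 K)) : ℂ)
  map_one' := by simp [tt]
  map_mul' a b := by
    rw [map_mul, Submonoid.coe_mul, tt_mul]; push_cast; ring

lemma FM_norm_le (χ : DirichletCharacter ℂ n) (ψ : ClassGroup (𝓞 K) →* ℂˣ) (s : ℝ)
    (𝔞 : (Ideal (𝓞 K))⁰) : ‖FM χ ψ s 𝔞‖ ≤ tt s (𝔞 : Ideal (𝓞 K)) := by
  change ‖fch χ ψ 𝔞 * (tt s (𝔞 : Ideal (𝓞 K)) : ℂ)‖ ≤ _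
  rw [norm_mul, Complex.norm_real, Real.norm_of_nonneg (tt_nonneg s _)]
  exact mul_le_of_le_one_left (tt_nonneg s _) (fch_le χ ψ 𝔞)

lemma tt_sq_le {s : ℝ} (hs : 1 < s) (𝔞 : (Ideal (𝓞 K))⁰) :
    tt s (𝔞 : Ideal (𝓞 K)) ^ 2 ≤ tt 2 (𝔞 : Ideal (𝓞 K)) := by
  have h1 : (1 : ℝ) ≤ (absNorm (𝔞 : Ideal (𝓞 K)) : ℝ) := by
    exact_mod_cast (absNorm_pos 𝔞)
  unfold tt
  rw [← Real.rpow_natCast, ← Real.rpow_mul (by positivity)]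
  apply Real.rpow_le_rpow_of_exponent_le h1
  push_cast; linarith

lemma sum_bound (ψ : ClassGroup (𝓞 K) →* ℂˣ)
    (hdep : ∀ a b : 𝓞 K, ((absNorm (span {a + n * b}) : ℕ) : ZMod n) = (absNorm (span {a}) : ℕ))
    (hc : ∀ χ : DirichletCharacter ℂ n, ∃ 𝔠 : (Ideal (𝓞 K))⁰,
      (𝔠 : Ideal (𝓞 K)) ⊔ span {(n : 𝓞 K)} = ⊤ ∧ fch χ ψ 𝔠 ≠ 1)
    (hψ : ∀ 𝔮 : (Ideal (𝓞 K))⁰, Prime (𝔮 : Ideal (𝓞 K)) →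
      ((absNorm (𝔮 : Ideal (𝓞 K)) : ℕ) : ZMod n) = 1 → ψ (ClassGroup.mk0 𝔮) = 1) :
    ∃ B : ℝ, ∀ S : Finset (Ideal (𝓞 K))⁰, (∀ 𝔮 ∈ S, Prime (𝔮 : Ideal (𝓞 K)) ∧
      ((absNorm (𝔮 : Ideal (𝓞 K)) : ℕ) : ZMod n) = 1) →
      ∑ 𝔮 ∈ S, ((absNorm (𝔮 : Ideal (𝓞 K)) : ℝ))⁻¹ ≤ B := by
  classical
  have h0 : ∀ χ : DirichletCharacter ℂ n, ∃ B : ℝ,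
      ∀ᶠ s in nhdsWithin (1 : ℝ) (Set.Ioi 1), ‖LL χ ψ s‖ ≤ B := by
    intro χ
    obtain ⟨𝔠, h1, h2⟩ := hc χ
    exact LL_bdd χ ψ hdep 𝔠 h1 h2
  choose B hB using h0
  set T : ℝ := ∑' 𝔞 : (Ideal (𝓞 K))⁰, tt 2 (𝔞 : Ideal (𝓞 K)) with hT
  set B' : ℝ := ∑ χ : DirichletCharacter ℂ n, (Real.log (2 * B χ) + T / 2) with hB'
  have hφ : 0 < (n.totient : ℝ) := by
    exact_mod_cast Nat.totient_pos.mpr (NeZero.pos n)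
  refine ⟨B' / n.totient, fun S hS => ?_⟩
  have key : ∀ᶠ s in nhdsWithin (1 : ℝ) (Set.Ioi 1),
      ∑ 𝔮 ∈ S, tt s (𝔮 : Ideal (𝓞 K)) ≤ B' / n.totient := by
    have hall := Filter.eventually_all.mpr hB
    filter_upwards [hall, self_mem_nhdsWithin] with s hs hs1
    have hs1 : 1 < s := hs1
    have he : ∀ χ : DirichletCharacter ℂ n, ∃ S₀ : Finset (Ideal (𝓞 K))⁰,
        (∀ 𝔮 ∈ S₀, Prime (𝔮 : Ideal (𝓞 K))) ∧ ∀ S, S₀ ⊆ S →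
        (∀ 𝔮 ∈ S, Prime (𝔮 : Ideal (𝓞 K))) →
        ∑ 𝔮 ∈ S, (FM χ ψ s 𝔮).re ≤ Real.log (2 * B χ) + T / 2 := by
      intro χ
      apply euler_bound (FM χ ψ s) _ (B χ) T (hs χ)
      · intro S
        calc _ ≤ ∑ 𝔮 ∈ S, tt 2 (𝔮 : Ideal (𝓞 K)) := by
              apply Finset.sum_le_sum
              intro 𝔮 _
              refine le_trans ?_ (tt_sq_le hs1 𝔮)
              gcongr
              exact FM_norm_le χ ψ s 𝔮
          _ ≤ T := (tt_summable one_lt_two).sum_le_tsum S (fun i _ => tt_nonneg 2 _)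
      · exact (tt_summable hs1).of_nonneg_of_le (fun _ => norm_nonneg _) (FM_norm_le χ ψ s)
    choose S₀ hS₀ hS₁ using he
    set S' := S ∪ Finset.univ.biUnion S₀ with hS'
    have hS'p : ∀ 𝔮 ∈ S', Prime (𝔮 : Ideal (𝓞 K)) := by
      intro 𝔮 h
      simp only [hS', Finset.mem_union, Finset.mem_biUnion, Finset.mem_univ, true_and] at h
      rcases h with h | ⟨χ, h⟩
      · exact (hS 𝔮 h).1
      · exact hS₀ χ 𝔮 h
    have h1 : ∑ χ : DirichletCharacter ℂ n, ∑ 𝔮 ∈ S', (FM χ ψ s 𝔮).re ≤ B' := by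
      apply Finset.sum_le_sum
      intro χ _
      apply hS₁ χ S' _ hS'p
      exact (Finset.subset_biUnion_of_mem S₀ (Finset.mem_univ χ)).trans Finset.subset_union_right
    rw [Finset.sum_comm] at h1
    have h2 : ∀ 𝔮 ∈ S', ∑ χ : DirichletCharacter ℂ n, (FM χ ψ s 𝔮).re =
        if ((absNorm (𝔮 : Ideal (𝓞 K)) : ℕ) : ZMod n) = 1 then
          n.totient * tt s (𝔮 : Ideal (𝓞 K)) else 0 := by
      intro 𝔮 h𝔮
      rw [← Complex.re_sum]
      have : ∑ χ : DirichletCharacter ℂ n, FM χ ψ s 𝔮 =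
          (ψ (ClassGroup.mk0 𝔮) : ℂ) * (tt s (𝔮 : Ideal (𝓞 K)) : ℂ) *
          ∑ χ : DirichletCharacter ℂ n, χ ((absNorm (𝔮 : Ideal (𝓞 K)) : ℕ) : ZMod n) := by
        rw [Finset.mul_sum]
        apply Finset.sum_congr rfl
        intro χ _
        simp only [FM, fch, MonoidHom.coe_mk, OneHom.coe_mk]
        ring
      rw [this, DirichletCharacter.sum_characters_eq]
      split_ifs with h
      · rw [hψ 𝔮 (hS'p 𝔮 h𝔮) h, Units.val_one, one_mul, mul_comm]
        rw [show ((n.totient : ℂ) * (tt s (𝔮 : Ideal (𝓞 K)) : ℂ)) =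
          ((n.totient * tt s (𝔮 : Ideal (𝓞 K)) : ℝ) : ℂ) by push_cast; rfl, Complex.ofReal_re]
      · simp
    rw [Finset.sum_congr rfl h2] at h1
    rw [le_div_iff₀ hφ, Finset.sum_mul]
    refine le_trans ?_ h1
    refine le_trans (Finset.sum_le_sum ?_) (Finset.sum_le_sum_of_subset_of_nonneg
      (Finset.subset_union_left : S ⊆ S') ?_)
    · intro 𝔮 h
      rw [if_pos (hS 𝔮 h).2, mul_comm]
    · intro 𝔮 _ _
      split_ifs
      · exact mul_nonneg hφ.le (tt_nonneg _ _)
      · exact le_rfl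
  have hlim : Filter.Tendsto (fun s : ℝ => ∑ 𝔮 ∈ S, tt s (𝔮 : Ideal (𝓞 K)))
      (nhdsWithin (1 : ℝ) (Set.Ioi 1))
      (nhds (∑ 𝔮 ∈ S, ((absNorm (𝔮 : Ideal (𝓞 K)) : ℝ))⁻¹)) := by
    apply tendsto_finsetSum
    intro 𝔮 _
    apply Filter.Tendsto.mono_left _ nhdsWithin_le_nhds
    have h1 : (0 : ℝ) < (absNorm (𝔮 : Ideal (𝓞 K)) : ℝ) := by
      exact_mod_cast (absNorm_pos 𝔮)
    have : ContinuousAt (fun s : ℝ => tt s (𝔮 : Ideal (𝓞 K))) 1 := by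
      unfold tt
      exact ContinuousAt.rpow continuousAt_const continuousAt_neg (Or.inl h1.ne')
    have h3 := this.tendsto
    simp only [tt, Real.rpow_neg_one] at h3
    exact h3
  exact le_of_tendsto hlim key

end Comb

section Div
open ArithmeticFunction ArithmeticFunction.vonMangoldt

lemma not_summable_primes (M : ℕ) [NeZero M] :
    ¬ Summable (fun q : ℕ => if q.Prime ∧ (q : ZMod M) = 1 then (q : ℝ)⁻¹ else 0) := by
  intro hf
  set f := (fun q : ℕ => if q.Prime ∧ (q : ZMod M) = 1 then (q : ℝ)⁻¹ else 0) with hfdef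
  have hf0 : ∀ q, 0 ≤ f q := fun q => by simp only [hfdef]; split_ifs <;> positivity
  have hφ : 0 < (M.totient : ℝ)⁻¹ := by
    have : 0 < M.totient := Nat.totient_pos.mpr (NeZero.pos M)
    positivity
  set ε := (M.totient : ℝ)⁻¹ / 2 with hε
  have hε0 : 0 < ε := by positivity
  obtain ⟨S, hS⟩ := (summable_iff_vanishing_norm.mp hf) ε hε0
  have hg := summable_residueClass_non_primes_div (1 : ZMod M)
  set g := (fun n : ℕ ↦ (if n.Prime then 0 else residueClass (1 : ZMod M) n) / n) with hgdef
  have hg0 : ∀ q, 0 ≤ g q := fun q => by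
    simp only [hgdef]
    split_ifs
    · simp
    · exact div_nonneg (residueClass_nonneg _ _) (Nat.cast_nonneg _)
  obtain ⟨C, hC⟩ := LSeries_residueClass_lower_bound (q := M) (a := 1) isUnit_one
  set D := fun n : ℕ => if n ∈ S then vonMangoldt n / n else 0 with hD
  have hD0 : ∀ q, 0 ≤ D q := fun q => by
    simp only [hD]
    split_ifs
    · exact div_nonneg vonMangoldt_nonneg (Nat.cast_nonneg _)
    · exact le_rfl
  have hDs : Summable D := by
    apply summable_of_ne_finset_zero (s := S)
    intro n hn
    simp [hD, hn]
  set E := fun n : ℕ => if n ∈ S then 0 else f n with hE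
  have hE0 : ∀ q, 0 ≤ E q := fun q => by
    simp only [hE]
    split_ifs
    · exact le_rfl
    · exact hf0 q
  have hEs : Summable E := hf.of_nonneg_of_le hE0 (fun n => by
    simp only [hE]; split_ifs
    · exact hf0 n
    · exact le_rfl)
  have hEb : ∑' n, E n ≤ ε := by
    apply hEs.tsum_le_of_sum_le
    intro s
    have h1 : ∑ n ∈ s, E n = ∑ n ∈ s \ S, f n := by
      rw [← Finset.filter_notMem_eq_sdiff, Finset.sum_filter]
      apply Finset.sum_congr rfl
      intro n _
      by_cases h : n ∈ S <;> simp [hE, h]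
    rw [h1]
    exact (le_abs_self _).trans (hS _ (Finset.sdiff_disjoint)).le
  have main : ∀ x ∈ Set.Ioc (1 : ℝ) 2, ε ≤ (C + ∑' n, g n + ∑' n, D n) * (x - 1) := by
    intro x hx
    have hx1 : 0 < x - 1 := by linarith [hx.1]
    have hle : ∀ n : ℕ, residueClass (1 : ZMod M) n / (n : ℝ) ^ x ≤
        g n + D n + (1 / (x - 1)) * E n := by
      intro n
      rcases Nat.eq_zero_or_pos n with rfl | hn
      · have : (vonMangoldt 0) = 0 := by simp
        have : residueClass (1 : ZMod M) 0 = 0 := by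
          simp [residueClass, Set.indicator_apply]
        rw [this, zero_div]
        have := hg0 0
        have := hD0 0
        have := mul_nonneg (one_div_pos.mpr hx1).le (hE0 0)
        linarith
      have hn1 : (1 : ℝ) ≤ n := by exact_mod_cast hn
      have hnx : (n : ℝ) ≤ (n : ℝ) ^ x := by
        conv_lhs => rw [← Real.rpow_one (n : ℝ)]
        exact Real.rpow_le_rpow_of_exponent_le hn1 hx.1.le
      have hE' := mul_nonneg (one_div_pos.mpr hx1).le (hE0 n)
      by_cases hp : n.Prime
      · by_cases hM : (n : ZMod M) = 1
        · have hr : residueClass (1 : ZMod M) n = vonMangoldt n := by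
            simp [residueClass, Set.indicator_apply, hM]
          rw [hr]
          by_cases hnS : n ∈ S
          · have : D n = vonMangoldt n / n := by simp [hD, hnS]
            have h2 : vonMangoldt n / (n : ℝ) ^ x ≤ vonMangoldt n / n := by
              gcongr
            linarith [hg0 n]
          · have h3 : E n = (n : ℝ)⁻¹ := by simp [hE, hnS, hfdef, hp, hM]
            have h4 : vonMangoldt n / (n : ℝ) ^ x ≤ 1 / (x - 1) * E n := by
              rw [vonMangoldt_apply_prime hp, h3]
              have h5 := Real.log_le_rpow_div (x := (n : ℝ)) (by positivity) hx1
              have h6 : (n : ℝ) ^ x = n * (n : ℝ) ^ (x - 1) := by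
                rw [mul_comm, ← Real.rpow_add_one (by positivity)]; congr 1; ring
              rw [div_le_iff₀ (by positivity), h6]
              calc _ ≤ _ := h5
                _ = _ := by field_simp
            linarith [hg0 n, hD0 n]
        · have hr : residueClass (1 : ZMod M) n = 0 := by
            simp [residueClass, Set.indicator_apply, hM]
          rw [hr, zero_div]
          linarith [hg0 n, hD0 n]
      · have h1 : g n = residueClass (1 : ZMod M) n / n := by simp [hgdef, hp]
        have h2 : residueClass (1 : ZMod M) n / (n : ℝ) ^ x ≤ residueClass (1 : ZMod M) n / n := by
          gcongr
          exact residueClass_nonneg _ _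
        linarith [hD0 n]
    have hsum := (hg.add hDs).add (hEs.mul_left (1 / (x - 1)))
    have h1 := hC hx
    have h2 : ∑' n, residueClass (1 : ZMod M) n / (n : ℝ) ^ x ≤
        ∑' n, (g n + D n + (1 / (x - 1)) * E n) := by
      apply Summable.tsum_le_tsum hle _ hsum
      exact hsum.of_nonneg_of_le
        (fun n => div_nonneg (residueClass_nonneg _ _) (by positivity)) hle
    rw [(hg.add hDs).tsum_add (hEs.mul_left _), hg.tsum_add hDs, tsum_mul_left] at h2
    have h3 : 1 / (x - 1) * ∑' n, E n ≤ 1 / (x - 1) * ε := by gcongr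
    have h4 : (M.totient : ℝ)⁻¹ / (x - 1) = 2 * (1 / (x - 1) * ε) := by rw [hε]; ring
    have h5 : 1 / (x - 1) * ε ≤ C + ∑' n, g n + ∑' n, D n := by linarith
    calc ε = (1 / (x - 1) * ε) * (x - 1) := by field_simp
      _ ≤ _ := by gcongr
  set Q := C + ∑' n, g n + ∑' n, D n with hQ
  have hQ0 : 0 < Q := by
    have := main 2 (by norm_num)
    linarith
  have := main (1 + min 1 (ε / (2 * Q))) (by
    constructor
    · have : 0 < min 1 (ε / (2 * Q)) := by positivity
      linarith
    · have : min 1 (ε / (2 * Q)) ≤ 1 := min_le_left _ _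
      linarith)
  have h2 : Q * (1 + min 1 (ε / (2 * Q)) - 1) ≤ ε / 2 := by
    calc _ = Q * min 1 (ε / (2 * Q)) := by ring
      _ ≤ Q * (ε / (2 * Q)) := by gcongr; exact min_le_right _ _
      _ = _ := by field_simp
  linarith

end Div

section Cyc
open Module Ideal

variable {K : Type*} [Field K] [NumberField K]

lemma adj_top {m : ℕ} [NeZero m] [IsCyclotomicExtension {m} ℚ K] {ζ : 𝓞 K}
    (hζ : IsPrimitiveRoot ζ m) : Algebra.adjoin ℤ {ζ} = ⊤ := by
  have h : IsPrimitiveRoot (algebraMap (𝓞 K) K ζ) m :=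
    hζ.map_of_injective (FaithfulSMul.algebraMap_injective (𝓞 K) K)
  have h2 := IsCyclotomicExtension.Rat.adjoin_singleton_eq_top h
  have h3 : h.toInteger = ζ := by ext; rfl
  rw [h3] at h2
  exact h2

lemma hom_ext_zeta {m : ℕ} [NeZero m] [IsCyclotomicExtension {m} ℚ K] {ζ : 𝓞 K}
    (hζ : IsPrimitiveRoot ζ m) {R : Type*} [Ring R] (f g : 𝓞 K →+* R) (h : f ζ = g ζ) :
    f = g := by
  have := AlgHom.ext_of_adjoin_eq_top (adj_top hζ) (φ₁ := f.toIntAlgHom) (φ₂ := g.toIntAlgHom)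
    (by intro x hx; rw [Set.mem_singleton_iff.mp hx]; exact h)
  ext x
  exact DFunLike.congr_fun this x

lemma absNorm_le_of_frob {m : ℕ} [NeZero m] [IsCyclotomicExtension {m} ℚ K] {ζ : 𝓞 K}
    (hζ : IsPrimitiveRoot ζ m) (Q : Ideal (𝓞 K)) (hQ : Q.IsMaximal) (p f : ℕ) (hp : p.Prime)
    (hf : f ≠ 0) (hpQ : (p : 𝓞 K) ∈ Q) (h : ζ ^ (p ^ f) - ζ ∈ Q) : absNorm Q ≤ p ^ f := by
  letI := Ideal.Quotient.field Q
  have hc : CharP (𝓞 K ⧸ Q) p := by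
    refine (CharP.charP_iff_prime_eq_zero hp).mpr ?_
    have := Ideal.Quotient.eq_zero_iff_mem.mpr hpQ
    simpa using this
  haveI : Fact p.Prime := ⟨hp⟩
  have he : (iterateFrobenius (𝓞 K ⧸ Q) p f).comp (Ideal.Quotient.mk Q) = Ideal.Quotient.mk Q := by
    apply hom_ext_zeta hζ
    rw [RingHom.comp_apply, iterateFrobenius_def, ← map_pow]
    exact Ideal.Quotient.eq.mpr h
  have hroot : ∀ x : 𝓞 K ⧸ Q, x ^ (p ^ f) = x := by
    intro x
    obtain ⟨y, rfl⟩ := Ideal.Quotient.mk_surjective x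
    have := DFunLike.congr_fun he y
    rwa [RingHom.comp_apply, iterateFrobenius_def] at this
  have h1 : 1 < p ^ f := Nat.one_lt_pow hf hp.one_lt
  classical
  have hne := FiniteField.X_pow_card_sub_X_ne_zero (𝓞 K ⧸ Q) h1
  have hall : ∀ x : 𝓞 K ⧸ Q, x ∈ (Polynomial.X ^ (p ^ f) - Polynomial.X :
      Polynomial (𝓞 K ⧸ Q)).roots.toFinset := by
    intro x
    rw [Multiset.mem_toFinset, Polynomial.mem_roots hne]
    simp [hroot x]
  letI : Fintype (𝓞 K ⧸ Q) := ⟨_, hall⟩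
  rw [absNorm_apply, Submodule.cardQuot_apply, Nat.card_eq_fintype_card]
  calc Fintype.card (𝓞 K ⧸ Q) ≤ (Polynomial.X ^ (p ^ f) - Polynomial.X :
      Polynomial (𝓞 K ⧸ Q)).roots.toFinset.card := le_rfl
    _ ≤ _ := Multiset.toFinset_card_le _
    _ ≤ _ := Polynomial.card_roots' _
    _ = p ^ f := FiniteField.X_pow_card_sub_X_natDegree_eq _ h1

/-- primes over `q = 1 mod m` -/
lemma exists_prime_over {m : ℕ} [NeZero m] [IsCyclotomicExtension {m} ℚ K] {ζ : 𝓞 K}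
    (hζ : IsPrimitiveRoot ζ m) (q : ℕ) (hq : q.Prime) (hqm : (q : ZMod m) = 1) :
    ∃ Q : (Ideal (𝓞 K))⁰, Prime (Q : Ideal (𝓞 K)) ∧ absNorm (Q : Ideal (𝓞 K)) = q := by
  haveI : (span {(q : ℤ)}).IsMaximal :=
    PrincipalIdealRing.isMaximal_of_irreducible (Nat.prime_iff_prime_int.mp hq).irreducible
  obtain ⟨Q, hQ, hQl⟩ := Ideal.exists_maximal_ideal_liesOver_of_isIntegral (S := 𝓞 K)
    (span {(q : ℤ)})
  have hqp := Nat.prime_iff_prime_int.mp hq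
  have hqQ : (q : 𝓞 K) ∈ Q := by
    have h1 : (q : ℤ) ∈ Q.under ℤ := by
      rw [← hQl.over]; exact Ideal.mem_span_singleton_self _
    have h2 := Ideal.mem_comap.mp h1
    simpa using h2
  have hQ0 : Q ≠ ⊥ := by
    intro h
    rw [h, Ideal.mem_bot] at hqQ
    exact hq.ne_zero (by exact_mod_cast hqQ)
  have hle : absNorm Q ≤ q ^ 1 := by
    apply absNorm_le_of_frob hζ Q hQ q 1 hq one_ne_zero hqQ
    have : ζ ^ q = ζ := by
      have h1 : q ≡ 1 [MOD m] := (ZMod.natCast_eq_natCast_iff q 1 m).mp (by simpa using hqm)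
      have h2 := (pow_eq_pow_iff_modEq (x := hζ.isUnit (NeZero.ne m) |>.unit)
        (n := q) (m := 1)).mpr ?_
      · have h3 := congrArg Units.val h2
        simpa using h3
      · have h4 : orderOf (hζ.isUnit (NeZero.ne m)).unit = m := by
          rw [← orderOf_units]; simpa using hζ.eq_orderOf.symm
        rw [h4]; exact h1
    rw [pow_one, this, sub_self]; exact Q.zero_mem
  rw [pow_one] at hle
  refine ⟨⟨Q, mem_nonZeroDivisors_of_ne_zero hQ0⟩, Ideal.prime_of_isPrime hQ0 hQ.isPrime, ?_⟩
  have h5 : absNorm Q ∣ q ^ finrank ℚ K := by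
    have := absNorm_dvd_norm_of_mem hqQ
    rw [show (q : 𝓞 K) = algebraMap ℤ (𝓞 K) q by simp, Algebra.norm_algebraMap,
      RingOfIntegers.rank] at this
    exact_mod_cast this
  obtain ⟨k, hk, hk2⟩ := (Nat.dvd_prime_pow hq).mp h5
  have hk0 : k ≠ 0 := by
    rintro rfl
    rw [pow_zero, absNorm_eq_one_iff] at hk2
    exact hQ.ne_top hk2
  refine le_antisymm hle ?_
  change q ≤ absNorm Q
  rw [hk2]
  exact Nat.le_self_pow hk0 q

variable {L : Type*} [Field L] [NumberField L] [Algebra L K]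

lemma absNorm_relNorm_nf (I : Ideal (𝓞 K)) : absNorm (relNorm (𝓞 L) I) = absNorm I := by
  apply absNorm_relNorm

lemma relNorm_prime {m n d : ℕ} [NeZero m] [IsCyclotomicExtension {m} ℚ K] {ζ : 𝓞 K}
    (hζ : IsPrimitiveRoot ζ m) (hmnd : m = n * d) (hcop : n.Coprime d)
    (ξ : 𝓞 L) (hξ : algebraMap (𝓞 L) (𝓞 K) ξ = ζ ^ n)
    (Q : Ideal (𝓞 K)) (hQ : Q.IsMaximal) (𝔮 : Ideal (𝓞 L)) (h𝔮 : 𝔮.IsMaximal) (h𝔮0 : 𝔮 ≠ ⊥)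
    (hl : Q.LiesOver 𝔮) (hN : ((absNorm 𝔮 : ℕ) : ZMod n) = 1) : relNorm (𝓞 L) Q = 𝔮 := by
  letI := Ideal.Quotient.field 𝔮
  haveI : Finite (𝓞 L ⧸ 𝔮) := Ideal.finiteQuotientOfFreeOfNeBot 𝔮 h𝔮0
  letI := Fintype.ofFinite (𝓞 L ⧸ 𝔮)
  obtain ⟨p, hpc, f, hp, hcard⟩ := FiniteField.card' (𝓞 L ⧸ 𝔮)
  have hNq : absNorm 𝔮 = p ^ (f : ℕ) := by
    rw [absNorm_apply, Submodule.cardQuot_apply, Nat.card_eq_fintype_card, hcard]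
  have hmem : ∀ x : 𝓞 L, x ∈ 𝔮 → algebraMap (𝓞 L) (𝓞 K) x ∈ Q := by
    intro x hx
    rw [hl.over] at hx
    exact hx
  have hpQ : (p : 𝓞 K) ∈ Q := by
    have h1 : (p : 𝓞 L) ∈ 𝔮 := by
      apply Ideal.Quotient.eq_zero_iff_mem.mp
      have := CharP.cast_eq_zero (𝓞 L ⧸ 𝔮) p
      simpa using this
    simpa using hmem _ h1
  have hle : absNorm Q ≤ p ^ (f : ℕ) := by
    apply absNorm_le_of_frob hζ Q hQ p f hp f.ne_zero hpQ
    rw [← hNq]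
    set q := absNorm 𝔮 with hq
    have hq1 : 1 ≤ q := by
      rw [hNq]; exact Nat.one_le_pow _ _ hp.pos
    obtain ⟨r, hr⟩ : ∃ r, q = r + 1 := ⟨q - 1, by omega⟩
    have hnr : n ∣ r := by
      rw [← ZMod.natCast_eq_zero_iff]
      rw [hr] at hN; push_cast at hN
      simpa using hN
    have hA : (Ideal.Quotient.mk Q (ζ ^ r)) ^ n = 1 := by
      have h1 : ξ ^ q - ξ ∈ 𝔮 := by
        apply Ideal.Quotient.eq.mp
        rw [map_pow, hNq, ← hcard]
        exact FiniteField.pow_card _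
      have h2 := hmem _ h1
      rw [map_sub, map_pow, hξ] at h2
      have hu : IsUnit (ζ ^ n) := (hζ.isUnit (NeZero.ne m)).pow n
      have h3 : (ζ ^ r) ^ n - 1 ∈ Q := by
        have h4 : (ζ ^ n) ^ q - ζ ^ n = (ζ ^ n) * ((ζ ^ r) ^ n - 1) := by
          rw [hr]; ring
        rw [h4] at h2
        exact (Ideal.unit_mul_mem_iff_mem Q hu).mp h2
      rw [← map_pow]
      exact Ideal.Quotient.eq.mpr h3
    have hB : (Ideal.Quotient.mk Q (ζ ^ r)) ^ d = 1 := by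
      obtain ⟨k, rfl⟩ := hnr
      rw [← map_pow]
      have : (ζ ^ (n * k)) ^ d = 1 := by
        calc _ = (ζ ^ (n * d)) ^ k := by ring
          _ = 1 := by rw [← hmnd, hζ.pow_eq_one, one_pow]
      rw [this, map_one]
    have hC : Ideal.Quotient.mk Q (ζ ^ r) = 1 := by
      have h1 := orderOf_dvd_of_pow_eq_one hA
      have h2 := orderOf_dvd_of_pow_eq_one hB
      have h3 := Nat.dvd_gcd h1 h2
      rw [hcop] at h3
      exact orderOf_eq_one_iff.mp (Nat.dvd_one.mp h3)
    have hD : ζ ^ r - 1 ∈ Q := Ideal.Quotient.eq.mp (by rw [hC, map_one])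
    have hE : ζ ^ q - ζ = ζ * (ζ ^ r - 1) := by rw [hr]; ring
    rw [hE]
    exact Q.mul_mem_left _ hD
  haveI := h𝔮.isPrime
  obtain ⟨s, hs⟩ := Ideal.exists_relNorm_eq_pow_of_isPrime Q 𝔮
  have hNs : absNorm Q = (absNorm 𝔮) ^ s := by
    rw [← absNorm_relNorm_nf (L := L), hs, map_pow]
  have hq1 : 1 < absNorm 𝔮 := by
    rw [hNq]; exact Nat.one_lt_pow f.ne_zero hp.one_lt
  have hs1 : s = 1 := by
    rw [← hNq, hNs] at hle
    have h1 : s ≤ 1 := by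
      by_contra! h
      have := Nat.pow_lt_pow_right hq1 h
      simp only [pow_one] at this
      omega
    have h2 : s ≠ 0 := by
      rintro rfl
      rw [pow_zero, absNorm_eq_one_iff] at hNs
      exact hQ.ne_top hNs
    omega
  rw [hs, hs1, pow_one]

lemma relNorm_class (I I' : (Ideal (𝓞 K))⁰) (h : ClassGroup.mk0 I = ClassGroup.mk0 I')
    (J J' : (Ideal (𝓞 L))⁰) (hJ : relNorm (𝓞 L) (I : Ideal (𝓞 K)) = J)
    (hJ' : relNorm (𝓞 L) (I' : Ideal (𝓞 K)) = J') : ClassGroup.mk0 J = ClassGroup.mk0 J' := by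
  obtain ⟨x, y, hx, hy, hxy⟩ := ClassGroup.mk0_eq_mk0_iff.mp h
  refine ClassGroup.mk0_eq_mk0_iff.mpr ⟨Algebra.intNorm (𝓞 L) (𝓞 K) x,
    Algebra.intNorm (𝓞 L) (𝓞 K) y, ?_, ?_, ?_⟩
  · simpa using hx
  · simpa using hy
  · rw [← hJ, ← hJ', ← relNorm_singleton, ← relNorm_singleton, ← map_mul, ← map_mul, hxy]

end Cyc

section NormMod
open Module Ideal

variable {L : Type*} [Field L] [NumberField L]

lemma norm_mod {n : ℕ} {B : Type*} [CommRing B] [Algebra (ZMod n) B]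
    (π : 𝓞 L →+* B) (hs : Function.Surjective π) (hk : ∀ x, π x = 0 ↔ x ∈ span {(n : 𝓞 L)})
    (a : 𝓞 L) : Algebra.norm (ZMod n) (π a) = ((Algebra.norm ℤ a : ℤ) : ZMod n) := by
  classical
  let b := RingOfIntegers.basis L
  have hint : ∀ (z : ℤ) (y : 𝓞 L), π (z • y) = (z : ZMod n) • π y := by
    intro z y
    rw [map_zsmul, Int.cast_smul_eq_zsmul]
  have hli : LinearIndependent (ZMod n) (fun i => π (b i)) := by
    rw [Fintype.linearIndependent_iff]
    intro c hc i
    choose z hz using fun i => ZMod.intCast_surjective (c i)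
    have h1 : π (∑ i, z i • b i) = 0 := by
      rw [map_sum, ← hc]
      apply Finset.sum_congr rfl
      intro j _
      rw [hint, hz]
    rw [hk, mem_span_singleton] at h1
    obtain ⟨y, hy⟩ := h1
    have h2 := congrArg (fun w => b.repr w i) hy
    simp only [Basis.repr_sum_self] at h2
    rw [show (n : 𝓞 L) * y = (n : ℤ) • y by simp, map_zsmul, Finsupp.smul_apply] at h2
    rw [← hz, h2]
    simp
  have hsp : ⊤ ≤ Submodule.span (ZMod n) (Set.range fun i => π (b i)) := by
    intro x _
    obtain ⟨y, rfl⟩ := hs x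
    rw [← b.sum_repr y, map_sum]
    apply Submodule.sum_mem
    intro i _
    rw [hint]
    exact Submodule.smul_mem _ _ (Submodule.subset_span ⟨i, rfl⟩)
  let b' := Basis.mk hli hsp
  have hb' : ∀ i, b' i = π (b i) := fun i => by simp [b']
  have hr : ∀ y i, b'.repr (π y) i = ((b.repr y i : ℤ) : ZMod n) := by
    intro y i
    have h1 : π y = ∑ i, ((b.repr y i : ℤ) : ZMod n) • b' i := by
      conv_lhs => rw [← b.sum_repr y, map_sum]
      simp only [hint, hb']
    rw [h1, Basis.repr_sum_self]
  rw [Algebra.norm_eq_matrix_det b', Algebra.norm_eq_matrix_det b, ← eq_intCast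
    (Int.castRingHom (ZMod n)), RingHom.map_det]
  congr 1
  ext i j
  rw [RingHom.mapMatrix_apply, Matrix.map_apply, Algebra.leftMulMatrix_eq_repr_mul,
    Algebra.leftMulMatrix_eq_repr_mul, hb', ← map_mul, hr]
  simp

/-- algebra structure -/
@[reducible] noncomputable def zalg (n : ℕ) {B : Type*} [CommRing B] (h : (n : B) = 0) :
    Algebra (ZMod n) B :=
  (ZMod.castHom (ringChar.dvd h) B).toAlgebra

lemma norm_dep (n : ℕ) (a b : 𝓞 L) (h : a - b ∈ span {(n : 𝓞 L)}) :
    ((Algebra.norm ℤ a : ℤ) : ZMod n) = ((Algebra.norm ℤ b : ℤ) : ZMod n) := by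
  have h0 : ((n : ℕ) : 𝓞 L ⧸ span {(n : 𝓞 L)}) = 0 := by
    have := Ideal.Quotient.eq_zero_iff_mem.mpr (Ideal.mem_span_singleton_self (n : 𝓞 L))
    simpa using this
  letI := zalg n h0
  rw [← norm_mod (Ideal.Quotient.mk (span {(n : 𝓞 L)})) Ideal.Quotient.mk_surjective
    (fun x => Ideal.Quotient.eq_zero_iff_mem), ← norm_mod (Ideal.Quotient.mk (span {(n : 𝓞 L)}))
    Ideal.Quotient.mk_surjective (fun x => Ideal.Quotient.eq_zero_iff_mem),
    Ideal.Quotient.eq.mpr h]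

lemma norm_prod_alg {k A B : Type*} [Field k] [CommRing A] [CommRing B] [Algebra k A] [Algebra k B]
    [Module.Finite k A] [Module.Finite k B] (x : A × B) :
    Algebra.norm k x = Algebra.norm k x.1 * Algebra.norm k x.2 := by
  rw [Algebra.norm_apply, Algebra.norm_apply, Algebra.norm_apply, ← LinearMap.det_prodMap]
  congr 1

lemma norm_nonneg_cyc {d : ℕ} [NeZero d] [IsCyclotomicExtension {d} ℚ L] (hd : 2 < d)
    (x : 𝓞 L) : 0 ≤ Algebra.norm ℤ x := by
  classical
  have htc : IsTotallyComplex L := IsCyclotomicExtension.Rat.isTotallyComplex (n := d) L hd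
  have h1 : (∏ φ : L →+* ℂ, φ x) = (Algebra.norm ℚ (x : L) : ℂ) := by
    have := Algebra.norm_eq_prod_embeddings ℚ ℂ (x : L)
    rw [eq_ratCast] at this
    rw [this]
    exact Fintype.prod_equiv (RingHom.equivRatAlgHom L ℂ) _ _
      fun _ => by simp [RingHom.equivRatAlgHom_apply]
  have h2 : (∏ φ : L →+* ℂ, φ x) =
      ((∏ w : InfinitePlace L, (w x) ^ 2 : ℝ) : ℂ) := by
    rw [← Finset.prod_fiberwise Finset.univ InfinitePlace.mk (fun φ : L →+* ℂ => φ x)]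
    push_cast
    apply Finset.prod_congr rfl
    intro w _
    have hw : InfinitePlace.IsComplex w := htc.isComplex w
    have hne : w.embedding ≠ ComplexEmbedding.conjugate w.embedding := by
      intro h
      exact (InfinitePlace.isComplex_iff.mp hw) h.symm
    have hset : (Finset.univ.filter fun φ : L →+* ℂ => InfinitePlace.mk φ = w) =
        {w.embedding, ComplexEmbedding.conjugate w.embedding} := by
      ext φ
      simp only [Finset.mem_filter, Finset.mem_univ, true_and, Finset.mem_insert,
        Finset.mem_singleton]
      conv_lhs => rw [← InfinitePlace.mk_embedding w, InfinitePlace.mk_eq_iff]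
      constructor
      · rintro (h | h)
        · exact Or.inl h
        · right; rw [← h]; simp
      · rintro (h | h)
        · exact Or.inl h
        · right; rw [h]; simp
    rw [hset, Finset.prod_pair hne, ComplexEmbedding.conjugate_coe_eq, Complex.mul_conj]
    rw [Complex.normSq_eq_norm_sq, InfinitePlace.norm_embedding_eq]
    push_cast; rfl
  have h3 : (Algebra.norm ℚ (x : L) : ℝ) = ∏ w : InfinitePlace L, (w x) ^ 2 := by
    have := h1.symm.trans h2
    exact_mod_cast this
  have h4 : (0 : ℝ) ≤ (Algebra.norm ℚ (x : L) : ℝ) := by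
    rw [h3]; positivity
  rw [← Algebra.coe_norm_int] at h4
  exact_mod_cast h4

lemma absNorm_cast {d : ℕ} [NeZero d] [IsCyclotomicExtension {d} ℚ L] (hd : 2 < d) (n : ℕ)
    (x : 𝓞 L) : ((absNorm (span {x}) : ℕ) : ZMod n) = ((Algebra.norm ℤ x : ℤ) : ZMod n) := by
  rw [absNorm_span_singleton]
  have := norm_nonneg_cyc hd x
  conv_rhs => rw [← Int.natAbs_of_nonneg this]
  simp

lemma hdep_cyc {d : ℕ} [NeZero d] [IsCyclotomicExtension {d} ℚ L] (hd : 2 < d) (n : ℕ)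
    (a b : 𝓞 L) : ((absNorm (span {a + n * b}) : ℕ) : ZMod n) = (absNorm (span {a}) : ℕ) := by
  rw [absNorm_cast hd, absNorm_cast hd]
  apply norm_dep
  rw [add_sub_cancel_left]
  exact Ideal.mul_mem_right _ _ (Ideal.mem_span_singleton_self _)

lemma norm_surj_prime {d : ℕ} [NeZero d] [IsCyclotomicExtension {d} ℚ L] {ξ : 𝓞 L}
    (hξ : IsPrimitiveRoot ξ d) (p : ℕ) (hp : p.Prime) (hpd : p.Coprime d) (t : ZMod p) :
    ∃ v : 𝓞 L, ((Algebra.norm ℤ v : ℤ) : ZMod p) = t := by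
  haveI : Fact p.Prime := ⟨hp⟩
  have hp0 : (p : 𝓞 L) ≠ 0 := by exact_mod_cast hp.ne_zero
  have hpnu : ¬ IsUnit (p : 𝓞 L) := by
    intro h
    have h1 := h.map (Algebra.norm ℤ (S := 𝓞 L))
    rw [show (p : 𝓞 L) = algebraMap ℤ (𝓞 L) p by simp, Algebra.norm_algebraMap] at h1
    have h2 := (isUnit_pow_iff (M := ℤ) (finrank_pos (R := ℤ) (M := 𝓞 L)).ne').mp h1
    exact (Nat.prime_iff_prime_int.mp hp).not_isUnit h2
  -- reducedness
  have hred : ∀ x : 𝓞 L, x ^ 2 ∈ span {(p : 𝓞 L)} → x ∈ span {(p : 𝓞 L)} := by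
    have hc : CharP (𝓞 L ⧸ span {(p : 𝓞 L)}) p := by
      haveI : Nontrivial (𝓞 L ⧸ span {(p : 𝓞 L)}) :=
        Ideal.Quotient.nontrivial_iff.mpr (by rwa [Ne, span_singleton_eq_top])
      refine (CharP.charP_iff_prime_eq_zero hp).mpr ?_
      have := Ideal.Quotient.eq_zero_iff_mem.mpr (Ideal.mem_span_singleton_self (p : 𝓞 L))
      simpa using this
    have hf0 : 0 < d.totient := Nat.totient_pos.mpr (NeZero.pos d)
    have he : (iterateFrobenius (𝓞 L ⧸ span {(p : 𝓞 L)}) p d.totient).comp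
        (Ideal.Quotient.mk (span {(p : 𝓞 L)})) = Ideal.Quotient.mk (span {(p : 𝓞 L)}) := by
      apply hom_ext_zeta hξ
      rw [RingHom.comp_apply, iterateFrobenius_def, ← map_pow]
      congr 1
      have h1 : p ^ d.totient ≡ 1 [MOD d] := Nat.ModEq.pow_totient hpd
      have h2 := (Nat.ModEq.dvd h1.symm)
      obtain ⟨r, hr⟩ : ∃ r, p ^ d.totient = r + 1 :=
        ⟨p ^ d.totient - 1, by have := Nat.one_le_pow d.totient p hp.pos; omega⟩
      rw [hr] at h2 ⊢
      have h3 : d ∣ r := by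
        have h4 : (d : ℤ) ∣ (r : ℤ) := by simpa using h2
        exact_mod_cast h4
      obtain ⟨k, rfl⟩ := h3
      rw [pow_succ, pow_mul, hξ.pow_eq_one, one_pow, one_mul]
    intro x hx
    rw [← Ideal.Quotient.eq_zero_iff_mem] at hx ⊢
    have h1 := DFunLike.congr_fun he x
    rw [RingHom.comp_apply, iterateFrobenius_def] at h1
    rw [← h1]
    rw [map_pow] at hx
    apply pow_eq_zero_of_le _ hx
    have : 1 < p ^ d.totient := Nat.one_lt_pow hf0.ne' hp.one_lt
    omega
  obtain ⟨𝔓, h𝔓, hle⟩ := Ideal.exists_le_maximal (span {(p : 𝓞 L)})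
    (by rwa [Ne, span_singleton_eq_top])
  obtain ⟨𝔟, h𝔟⟩ := Ideal.dvd_iff_le.mpr hle
  have hspan0 : span {(p : 𝓞 L)} ≠ ⊥ := by rwa [Ne, span_singleton_eq_bot]
  have h𝔓0 : 𝔓 ≠ ⊥ := by rintro rfl; apply hspan0; rw [h𝔟]; simp
  have h𝔟0 : 𝔟 ≠ ⊥ := by rintro rfl; apply hspan0; rw [h𝔟]; simp
  have hcop : 𝔓 ⊔ 𝔟 = ⊤ := by
    by_contra hne
    have hb𝔓 : 𝔟 ≤ 𝔓 := by
      have := h𝔓.eq_of_le hne le_sup_left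
      rw [this]; exact le_sup_right
    have h1 : 𝔟 ≤ span {(p : 𝓞 L)} := by
      intro x hx
      apply hred
      rw [h𝔟, sq]
      exact Ideal.mul_mem_mul (hb𝔓 hx) hx
    have h2 : 𝔟 = 𝔓 * 𝔟 := le_antisymm (h𝔟 ▸ h1) Ideal.mul_le_right
    have h3 : 𝔓 = 1 := by
      have h4 : 𝔓 * 𝔟 = 1 * 𝔟 := by rw [one_mul]; exact h2.symm
      exact mul_right_cancel₀ h𝔟0 h4
    exact h𝔓.ne_top (by rw [h3, Ideal.one_eq_top])
  letI := Ideal.Quotient.field 𝔓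
  haveI : Finite (𝓞 L ⧸ 𝔓) := Ideal.finiteQuotientOfFreeOfNeBot 𝔓 h𝔓0
  haveI : Finite (𝓞 L ⧸ 𝔟) := Ideal.finiteQuotientOfFreeOfNeBot 𝔟 h𝔟0
  have hp𝔟 : (p : 𝓞 L) ∈ 𝔟 := by
    have h1 := Ideal.mem_span_singleton_self (p : 𝓞 L)
    rw [h𝔟] at h1
    exact Ideal.mul_le_right h1
  have hp𝔓 : (p : 𝓞 L) ∈ 𝔓 := hle (Ideal.mem_span_singleton_self (p : 𝓞 L))
  have hz1 : ((p : ℕ) : 𝓞 L ⧸ 𝔓) = 0 := by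
    simpa using Ideal.Quotient.eq_zero_iff_mem.mpr hp𝔓
  have hz2 : ((p : ℕ) : 𝓞 L ⧸ 𝔟) = 0 := by
    simpa using Ideal.Quotient.eq_zero_iff_mem.mpr hp𝔟
  letI := zalg p hz1
  letI := zalg p hz2
  obtain ⟨γ, hγ⟩ := FiniteField.norm_surjective (ZMod p) (𝓞 L ⧸ 𝔓) t
  have hcop' : IsCoprime 𝔓 𝔟 := Ideal.isCoprime_iff_sup_eq.mpr hcop
  let π : 𝓞 L →+* (𝓞 L ⧸ 𝔓) × (𝓞 L ⧸ 𝔟) :=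
    (Ideal.Quotient.mk 𝔓).prod (Ideal.Quotient.mk 𝔟)
  have hs : Function.Surjective π := by
    rintro ⟨x, y⟩
    obtain ⟨z, hz⟩ := (Ideal.quotientMulEquivQuotientProd 𝔓 𝔟 hcop').surjective (x, y)
    obtain ⟨w, rfl⟩ := Ideal.Quotient.mk_surjective z
    refine ⟨w, ?_⟩
    rw [← hz]
    rfl
  have hk : ∀ x, π x = 0 ↔ x ∈ span {(p : 𝓞 L)} := by
    intro x
    rw [h𝔟, ← Ideal.inf_eq_mul_of_isCoprime hcop', Ideal.mem_inf, ← Ideal.Quotient.eq_zero_iff_mem,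
      ← Ideal.Quotient.eq_zero_iff_mem]
    exact Prod.ext_iff
  obtain ⟨v, hv⟩ := hs (γ, 1)
  refine ⟨v, ?_⟩
  rw [← norm_mod π hs hk, hv, norm_prod_alg]
  simp [hγ]

lemma norm_surj {d : ℕ} [NeZero d] [IsCyclotomicExtension {d} ℚ L] {ξ : 𝓞 L}
    (hξ : IsPrimitiveRoot ξ d) (n : ℕ) (hn : Squarefree n) (hnd : n.Coprime d) (u : ℤ) :
    ∃ v : 𝓞 L, ((Algebra.norm ℤ v : ℤ) : ZMod n) = u := by
  have h1 : ∀ p : n.primeFactors, ∃ v : 𝓞 L, ((Algebra.norm ℤ v : ℤ) : ZMod p) = u := by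
    intro p
    have hp := Nat.mem_primeFactors.mp p.2
    exact norm_surj_prime hξ p hp.1 (Nat.Coprime.coprime_dvd_left hp.2.1 hnd) _
  choose w hw using h1
  obtain ⟨v, hv⟩ := Ideal.exists_forall_sub_mem_ideal
    (I := fun p : n.primeFactors => span {((p : ℕ) : 𝓞 L)})
    (by
      intro p q hpq
      have hp := Nat.mem_primeFactors.mp p.2
      have hq := Nat.mem_primeFactors.mp q.2
      have hc : Nat.Coprime p q := (Nat.coprime_primes hp.1 hq.1).mpr (fun h => hpq (Subtype.ext h))
      change IsCoprime _ _
      rw [Ideal.isCoprime_span_singleton_iff]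
      have h2 := (Nat.isCoprime_iff_coprime.mpr hc).map (Int.castRingHom (𝓞 L))
      simpa using h2) w
  refine ⟨v, ?_⟩
  have h3 : (n : ℤ) ∣ Algebra.norm ℤ v - u := by
    have h4 : ∀ p ∈ n.primeFactors, ((p : ℕ) : ℤ) ∣ Algebra.norm ℤ v - u := by
      intro p hp
      have h5 := norm_dep p v (w ⟨p, hp⟩) (hv ⟨p, hp⟩)
      have h6 := h5.trans (hw ⟨p, hp⟩)
      rw [← ZMod.intCast_zmod_eq_zero_iff_dvd]
      push_cast
      rw [h6, sub_self]
    have h7 : ((∏ p ∈ n.primeFactors, p : ℕ) : ℤ) ∣ Algebra.norm ℤ v - u := by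
      push_cast
      apply Finset.prod_dvd_of_coprime _ h4
      intro p hp q hq hpq
      have hp := Nat.mem_primeFactors.mp hp
      have hq := Nat.mem_primeFactors.mp hq
      exact Nat.isCoprime_iff_coprime.mpr ((Nat.coprime_primes hp.1 hq.1).mpr hpq)
    rwa [Nat.prod_primeFactors_of_squarefree hn] at h7
  have h8 := (ZMod.intCast_zmod_eq_zero_iff_dvd _ n).mpr h3
  push_cast at h8
  exact sub_eq_zero.mp h8

end NormMod

section Core
open Module Ideal

lemma mem_map_equiv_symm {R S : Type*} [CommRing R] [CommRing S] (σ : R ≃+* S) (I : Ideal R)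
    (x : S) : x ∈ Ideal.map σ I ↔ σ.symm x ∈ I := by
  rw [Ideal.mem_map_of_equiv]
  constructor
  · rintro ⟨y, hy, rfl⟩; simpa using hy
  · intro h; exact ⟨_, h, by simp⟩

lemma absNorm_map_equiv {L : Type*} [Field L] [NumberField L] (σ : 𝓞 L ≃+* 𝓞 L)
    (I : Ideal (𝓞 L)) : absNorm (Ideal.map σ I) = absNorm I := by
  rw [absNorm_apply, absNorm_apply, Submodule.cardQuot_apply, Submodule.cardQuot_apply]
  exact (Nat.card_congr (Ideal.quotientEquiv I (Ideal.map σ I) σ rfl).toEquiv).symm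

lemma map_equiv_ne_bot {L : Type*} [Field L] [NumberField L] (σ : 𝓞 L ≃+* 𝓞 L)
    (I : Ideal (𝓞 L)) (hI : I ≠ ⊥) : Ideal.map σ I ≠ ⊥ := by
  intro h
  apply hI
  rw [eq_bot_iff]
  intro x hx
  have := Ideal.mem_map_of_mem σ hx
  rw [h, Ideal.mem_bot] at this
  simpa using this

/-- image ideal as nonzero divisor -/
noncomputable def mapNZ {L : Type*} [Field L] [NumberField L] (σ : 𝓞 L ≃+* 𝓞 L)
    (I : (Ideal (𝓞 L))⁰) : (Ideal (𝓞 L))⁰ :=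
  ⟨Ideal.map σ (I : Ideal (𝓞 L)), mem_nonZeroDivisors_of_ne_zero
    (map_equiv_ne_bot σ _ (nonZeroDivisors.ne_zero I.2))⟩

lemma map_isMaximal {L : Type*} [Field L] [NumberField L] (σ : 𝓞 L ≃+* 𝓞 L)
    (I : Ideal (𝓞 L)) (hI : I.IsMaximal) : (Ideal.map σ I).IsMaximal :=
  Ideal.map_isMaximal_of_equiv σ

variable {L : Type*} [Field L] [NumberField L]

lemma exists_c {n d : ℕ} [NeZero n] [NeZero d] [IsCyclotomicExtension {d} ℚ L] (hd : 2 < d)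
    {ξ : 𝓞 L} (hξ : IsPrimitiveRoot ξ d) (hn : Squarefree n) (hnd : n.Coprime d)
    (ψ : ClassGroup (𝓞 L) →* ℂˣ) (x : ClassGroup (𝓞 L)) (hx : ψ x ≠ 1)
    (χ : DirichletCharacter ℂ n) : ∃ 𝔠 : (Ideal (𝓞 L))⁰,
      (𝔠 : Ideal (𝓞 L)) ⊔ span {(n : 𝓞 L)} = ⊤ ∧ fch χ ψ 𝔠 ≠ 1 := by
  by_cases hχ : χ = 1
  · subst hχ
    obtain ⟨𝔠, h1, h2⟩ := exists_coprime_rep n x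
    refine ⟨𝔠, h2, ?_⟩
    have h3 : IsUnit ((absNorm (𝔠 : Ideal (𝓞 L)) : ℕ) : ZMod n) :=
      (ZMod.isUnit_iff_coprime _ _).mpr (absNorm_coprime _ h2)
    simp only [fch, MonoidHom.coe_mk, OneHom.coe_mk]
    rw [h1, MulChar.one_apply h3, mul_one]
    intro h
    exact hx (Units.ext h)
  · have h1 : ∃ u : (ZMod n)ˣ, χ u ≠ 1 := by
      by_contra! h
      exact hχ (MulChar.ext fun u => by rw [h u, MulChar.one_apply_coe])
    obtain ⟨u, hu⟩ := h1
    obtain ⟨z, hz⟩ := ZMod.intCast_surjective (u : ZMod n)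
    obtain ⟨v, hv⟩ := norm_surj hξ n hn hnd z
    rw [← absNorm_cast hd, hz] at hv
    have hcop : Nat.Coprime (absNorm (span {v})) n := by
      rw [← ZMod.isUnit_iff_coprime, hv]; exact u.isUnit
    have htop : span {v} ⊔ span {(n : 𝓞 L)} = ⊤ := by
      rw [eq_top_iff_one]
      have h2 := (Nat.isCoprime_iff_coprime.mpr hcop).map (Int.castRingHom (𝓞 L))
      obtain ⟨a, b, hab⟩ := h2
      rw [← hab]
      refine Ideal.add_mem _ (Ideal.mul_mem_left _ _ ?_) (Ideal.mul_mem_left _ _ ?_)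
      · apply Ideal.mem_sup_left
        simpa using Ideal.absNorm_mem (span {v})
      · apply Ideal.mem_sup_right
        simpa using Ideal.mem_span_singleton_self (n : 𝓞 L)
    by_cases hv0 : v = 0
    · subst hv0
      refine ⟨1, by simp, ?_⟩
      exfalso
      rw [span_singleton_eq_bot.mpr rfl, bot_sup_eq, span_singleton_eq_top] at htop
      have hn1 : n = 1 := by
        by_contra hne
        have h1 := htop.map (Algebra.norm ℤ (S := 𝓞 L))
        rw [show (n : 𝓞 L) = algebraMap ℤ (𝓞 L) n by simp, Algebra.norm_algebraMap] at h1
        have h2 := (isUnit_pow_iff (M := ℤ) (finrank_pos (R := ℤ) (M := 𝓞 L)).ne').mp h1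
        rw [Int.ofNat_isUnit, Nat.isUnit_iff] at h2
        exact hne h2
      subst hn1
      apply hu
      rw [Subsingleton.elim u 1]; simp
    · refine ⟨⟨span {v}, mem_nonZeroDivisors_of_ne_zero
        (by simpa using hv0)⟩, htop, ?_⟩
      simp only [fch, MonoidHom.coe_mk, OneHom.coe_mk]
      have h5 : ClassGroup.mk0 (⟨span {v}, mem_nonZeroDivisors_of_ne_zero
        (by simpa using hv0)⟩ : (Ideal (𝓞 L))⁰) = 1 := by
        rw [ClassGroup.mk0_eq_one_iff]
        exact ⟨⟨v, rfl⟩⟩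
      rw [h5, map_one, Units.val_one, one_mul, hv]
      exact hu

lemma H_top {m n d : ℕ} [NeZero m] [NeZero n] [NeZero d] [IsCyclotomicExtension {d} ℚ L]
    (hd : 2 < d) {ξ : 𝓞 L} (hξ : IsPrimitiveRoot ξ d) (hmnd : m = n * d)
    (hn : Squarefree n) (hnd : n.Coprime d)
    (H : Subgroup (ClassGroup (𝓞 L)))
    (hH : ∀ 𝔮 : (Ideal (𝓞 L))⁰, Prime (𝔮 : Ideal (𝓞 L)) →
      ((absNorm (𝔮 : Ideal (𝓞 L)) : ℕ) : ZMod n) = 1 → ClassGroup.mk0 𝔮 ∈ H) (x) : x ∈ H := by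
  by_contra hx
  have hx' : (QuotientGroup.mk x : ClassGroup (𝓞 L) ⧸ H) ≠ 1 := by
    rwa [Ne, QuotientGroup.eq_one_iff]
  obtain ⟨φ, hφ⟩ := CommGroup.exists_apply_ne_one_of_hasEnoughRootsOfUnity
    (ClassGroup (𝓞 L) ⧸ H) ℂ hx'
  let ψ : ClassGroup (𝓞 L) →* ℂˣ := φ.comp (QuotientGroup.mk' H)
  obtain ⟨B, hB⟩ := sum_bound (n := n) ψ (hdep_cyc hd n)
    (fun χ => exists_c hd hξ hn hnd ψ x hφ χ) (by
      intro 𝔮 h1 h2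
      have h3 := hH 𝔮 h1 h2
      have h4 : (QuotientGroup.mk (ClassGroup.mk0 𝔮) : ClassGroup (𝓞 L) ⧸ H) = 1 := by
        rwa [QuotientGroup.eq_one_iff]
      change φ (QuotientGroup.mk (ClassGroup.mk0 𝔮)) = 1
      rw [h4, map_one])
  apply not_summable_primes m
  classical
  have hex : ∀ q : ℕ, ∃ Q : (Ideal (𝓞 L))⁰, q.Prime ∧ (q : ZMod m) = 1 →
      (Prime (Q : Ideal (𝓞 L)) ∧ absNorm (Q : Ideal (𝓞 L)) = q) := by
    intro q
    by_cases h : q.Prime ∧ (q : ZMod m) = 1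
    · have h1 : (q : ZMod d) = 1 := by
        have h2 := congrArg (ZMod.castHom (Dvd.intro_left n hmnd.symm : d ∣ m) (ZMod d)) h.2
        rwa [map_natCast, map_one] at h2
      obtain ⟨Q, hQ⟩ := exists_prime_over hξ q h.1 h1
      exact ⟨Q, fun _ => hQ⟩
    · exact ⟨1, fun h' => absurd h' h⟩
  choose Q hQ using hex
  refine summable_of_sum_le (c := B) (fun q => by dsimp only; split_ifs <;> positivity) ?_
  intro s
  rw [← Finset.sum_filter]
  have hmem : ∀ q ∈ s.filter (fun q : ℕ => q.Prime ∧ (q : ZMod m) = 1),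
      q.Prime ∧ (q : ZMod m) = 1 := fun q hq => (Finset.mem_filter.mp hq).2
  have h2 := hB ((s.filter (fun q : ℕ => q.Prime ∧ (q : ZMod m) = 1)).image Q) (by
    intro 𝔮 h𝔮
    obtain ⟨q, hq, rfl⟩ := Finset.mem_image.mp h𝔮
    have h3 := hmem q hq
    refine ⟨(hQ q h3).1, ?_⟩
    rw [(hQ q h3).2]
    have h2 := congrArg (ZMod.castHom (Dvd.intro d hmnd.symm : n ∣ m) (ZMod n)) h3.2
    rwa [map_natCast, map_one] at h2)
  rw [Finset.sum_image (by
    intro a ha b hb hab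
    rw [← (hQ a (hmem a ha)).2, ← (hQ b (hmem b hb)).2, hab])] at h2
  refine le_trans (le_of_eq ?_) h2
  apply Finset.sum_congr rfl
  intro q hq
  rw [(hQ q (hmem q hq)).2]

variable {K : Type*} [Field K] [NumberField K] [Algebra L K]

lemma core {m n d h : ℕ} [NeZero m] [NeZero n] [NeZero d] [IsCyclotomicExtension {d} ℚ L]
    [IsCyclotomicExtension {m} ℚ K]
    (hd : 2 < d) {ξ : 𝓞 L} (hξ : IsPrimitiveRoot ξ d) (hmnd : m = n * d)
    (hn : Squarefree n) (hnd : n.Coprime d) {ζ : 𝓞 K} (hζ : IsPrimitiveRoot ζ m)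
    (hξζ : algebraMap (𝓞 L) (𝓞 K) ξ = ζ ^ n)
    (σ : 𝓞 K ≃+* 𝓞 K) (hσ : σ ζ * ζ = 1) (σ' : 𝓞 L ≃+* 𝓞 L) (hσ' : σ' ξ * ξ = 1)
    (hK : ∀ I I' : (Ideal (𝓞 K))⁰, Ideal.map σ (I : Ideal (𝓞 K)) = I' →
      ClassGroup.mk0 I = ClassGroup.mk0 I') (hh : ∀ y : ClassGroup (𝓞 K), y ^ h = 1)
    (hodd : Odd h)
    (J' : ClassGroup (𝓞 L) →* ClassGroup (𝓞 L))
    (hJ' : ∀ I I' : (Ideal (𝓞 L))⁰, Ideal.map σ' (I : Ideal (𝓞 L)) = (I' : Ideal (𝓞 L)) →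
                J' (ClassGroup.mk0 I) = ClassGroup.mk0 I')
    (x : ClassGroup (𝓞 L)) (hx : J' x = x⁻¹) : x = 1 := by
  have hcomm : ∀ y : 𝓞 L, σ (algebraMap (𝓞 L) (𝓞 K) y) = algebraMap (𝓞 L) (𝓞 K) (σ' y) := by
    have h1 : (σ : 𝓞 K →+* 𝓞 K).comp (algebraMap (𝓞 L) (𝓞 K)) =
        (algebraMap (𝓞 L) (𝓞 K)).comp (σ' : 𝓞 L →+* 𝓞 L) := by
      apply hom_ext_zeta hξ
      simp only [RingHom.comp_apply, RingHom.coe_coe]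
      have hu : IsUnit (ζ ^ n) := (hζ.isUnit (NeZero.ne m)).pow n
      apply hu.mul_right_cancel
      rw [hξζ, map_pow, ← mul_pow, hσ, one_pow, ← hξζ, ← map_mul, hσ', map_one]
    intro y
    exact DFunLike.congr_fun h1 y
  let H : Subgroup (ClassGroup (𝓞 L)) :=
    (J'.eqLocus (MonoidHom.id _)) ⊓ (powMonoidHom h).ker
  have hxH : x ∈ H := by
    apply H_top hd hξ hmnd hn hnd H
    intro 𝔮 h𝔮 hN
    have h𝔮0 : (𝔮 : Ideal (𝓞 L)) ≠ ⊥ := nonZeroDivisors.ne_zero 𝔮.2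
    have h𝔮m : (𝔮 : Ideal (𝓞 L)).IsMaximal := (Ideal.isPrime_of_prime h𝔮).isMaximal h𝔮0
    obtain ⟨Q, hQ, hQl⟩ := Ideal.exists_maximal_ideal_liesOver_of_isIntegral (S := 𝓞 K)
      (𝔮 : Ideal (𝓞 L))
    have hr1 := relNorm_prime hζ hmnd hnd ξ hξζ Q hQ 𝔮 h𝔮m h𝔮0 hQl hN
    have hQ0 : Q ≠ ⊥ := by
      rintro rfl
      rw [relNorm_bot] at hr1
      exact h𝔮0 hr1.symm
    have hl2 : (Ideal.map σ Q).LiesOver (Ideal.map σ' (𝔮 : Ideal (𝓞 L))) := by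
      constructor
      ext y
      rw [mem_map_equiv_symm, Ideal.mem_comap, mem_map_equiv_symm]
      have h2 : σ.symm (algebraMap (𝓞 L) (𝓞 K) y) = algebraMap (𝓞 L) (𝓞 K) (σ'.symm y) := by
        apply σ.injective
        rw [hcomm]; simp
      rw [h2]
      conv_lhs => rw [hQl.over]
      exact Ideal.mem_comap
    have hr2 := relNorm_prime hζ hmnd hnd ξ hξζ (Ideal.map σ Q) (map_isMaximal σ Q hQ)
      (Ideal.map σ' (𝔮 : Ideal (𝓞 L))) (map_isMaximal σ' _ h𝔮m) (map_equiv_ne_bot σ' _ h𝔮0) hl2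
      (by rw [absNorm_map_equiv]; exact hN)
    let Q' : (Ideal (𝓞 K))⁰ := ⟨Q, mem_nonZeroDivisors_of_ne_zero hQ0⟩
    refine ⟨?_, ?_⟩
    · change J' (ClassGroup.mk0 𝔮) = ClassGroup.mk0 𝔮
      rw [hJ' 𝔮 (mapNZ σ' 𝔮) rfl]
      exact (relNorm_class Q' (mapNZ σ Q') (hK _ _ rfl) 𝔮 (mapNZ σ' 𝔮) hr1 hr2).symm
    · change (ClassGroup.mk0 𝔮) ^ h = 1
      rw [← map_pow, ← map_one ClassGroup.mk0]
      refine relNorm_class (Q' ^ h) 1 ?_ _ _ ?_ ?_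
      · rw [map_pow, hh, map_one]
      · rw [SubmonoidClass.coe_pow, SubmonoidClass.coe_pow, map_pow]
        exact congrArg (· ^ h) hr1
      · simp
  have h1 : J' x = x := hxH.1
  have h2 : x ^ h = 1 := hxH.2
  have h3 : x ^ 2 = 1 := by
    rw [sq]
    nth_rewrite 1 [← h1]
    rw [hx, inv_mul_cancel]
  have h4 := Nat.dvd_gcd (orderOf_dvd_of_pow_eq_one h2) (orderOf_dvd_of_pow_eq_one h3)
  have h5 : Nat.gcd h 2 = 1 := Nat.coprime_two_right.mpr hodd
  rw [h5] at h4
  exact orderOf_eq_one_iff.mp (Nat.dvd_one.mp h4)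

end Core

lemma triv_two {L : Type*} [Field L] [NumberField L] [IsCyclotomicExtension {2} ℚ L] (ξ : 𝓞 L)
    (hξ : IsPrimitiveRoot ξ 2) (x : ClassGroup (𝓞 L)) : x = 1 := by
  have h1 : ξ = -1 := hξ.eq_neg_one_of_two_right
  have h2 := adj_top (K := L) (m := 2) hξ
  have hs : Function.Surjective (algebraMap ℤ (𝓞 L)) := by
    intro y
    have hy : y ∈ Algebra.adjoin ℤ {ξ} := by rw [h2]; exact Algebra.mem_top
    have hle : Algebra.adjoin ℤ {ξ} ≤ ⊥ := by
      rw [Algebra.adjoin_le_iff]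
      rintro z hz
      rw [Set.mem_singleton_iff.mp hz, h1]
      exact neg_mem (one_mem _)
    exact Algebra.mem_bot.mp (hle hy)
  have : IsPrincipalIdealRing (𝓞 L) := IsPrincipalIdealRing.of_surjective (algebraMap ℤ (𝓞 L)) hs
  obtain ⟨I, rfl⟩ := ClassGroup.mk0_surjective x
  exact (ClassGroup.mk0_eq_one_iff I.2).mpr (IsPrincipalIdealRing.principal _)

lemma exists_emb {L K : Type*} [Field L] [NumberField L] [Field K] [NumberField K] {d : ℕ}
    [NeZero d] [IsCyclotomicExtension {d} ℚ L] {ξ : L} (hξ : IsPrimitiveRoot ξ d) {η : K}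
    (hη : IsPrimitiveRoot η d) : ∃ f : L →+* K, f ξ = η := by
  have h : Polynomial.aeval η (minpoly ℚ (hξ.powerBasis ℚ).gen) = 0 := by
    rw [IsPrimitiveRoot.powerBasis_gen, ← Polynomial.cyclotomic_eq_minpoly_rat hξ (NeZero.pos d),
      Polynomial.aeval_def, Polynomial.eval₂_eq_eval_map, Polynomial.map_cyclotomic]
    exact hη.isRoot_cyclotomic (NeZero.pos d)
  refine ⟨((hξ.powerBasis ℚ).lift η h : L →ₐ[ℚ] K), ?_⟩
  have h2 := (hξ.powerBasis ℚ).lift_gen η h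
  rw [IsPrimitiveRoot.powerBasis_gen] at h2
  exact h2

/-- For `m ≥ 2` squarefree: the subgroup `{x ∈ Cl_d : x̄ = x⁻¹}` is
trivial for every divisor `d ≥ 2` of `m` if and only if `h_m⁻ = 1`, where
`h_m⁻ = |{x ∈ Cl_m : x̄ = x⁻¹}|` is the minus part of the class number of the `m`-th
cyclotomic field. -/
theorem stmt_8 (m : ℕ+) (hm : 2 ≤ (m : ℕ)) (hsq : Squarefree (m : ℕ))
    (K : Type) [Field K] [NumberField K] [IsCyclotomicExtension {(m : ℕ)} ℚ K]
    (ζ : 𝓞 K) (hζ : IsPrimitiveRoot ζ (m : ℕ))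
    (σ : 𝓞 K ≃+* 𝓞 K) (hσ : σ ζ * ζ = 1)
    (J : ClassGroup (𝓞 K) →* ClassGroup (𝓞 K))
    (hJ : ∀ I I' : (Ideal (𝓞 K))⁰,
      Ideal.map σ (I : Ideal (𝓞 K)) = (I' : Ideal (𝓞 K)) →
      J (ClassGroup.mk0 I) = ClassGroup.mk0 I') :
    (∀ (d : ℕ+), 2 ≤ (d : ℕ) → d ∣ m →
      ∀ (L : Type) [Field L] [NumberField L] [IsCyclotomicExtension {(d : ℕ)} ℚ L],
        ∀ (ξ : 𝓞 L), IsPrimitiveRoot ξ (d : ℕ) →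
          ∀ (σ' : 𝓞 L ≃+* 𝓞 L), σ' ξ * ξ = 1 →
            ∀ (J' : ClassGroup (𝓞 L) →* ClassGroup (𝓞 L)),
              (∀ I I' : (Ideal (𝓞 L))⁰,
                Ideal.map σ' (I : Ideal (𝓞 L)) = (I' : Ideal (𝓞 L)) →
                J' (ClassGroup.mk0 I) = ClassGroup.mk0 I') →
              ∀ x : ClassGroup (𝓞 L), J' x = x⁻¹ → x = 1) ↔
      Nat.card {x : ClassGroup (𝓞 K) // J x = x⁻¹} = 1 := by
  have : NeZero (m : ℕ) := ⟨m.ne_zero⟩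
  constructor
  · intro hall
    have h1 := hall m hm dvd_rfl K ζ hζ σ hσ J hJ
    have : Subsingleton {x : ClassGroup (𝓞 K) // J x = x⁻¹} :=
      ⟨fun a b => Subtype.ext ((h1 a a.2).trans (h1 b b.2).symm)⟩
    have : Nonempty {x : ClassGroup (𝓞 K) // J x = x⁻¹} := ⟨⟨1, by simp⟩⟩
    exact Nat.card_eq_one_iff_unique.mpr ⟨inferInstance, inferInstance⟩
  · intro hcard d hd hdm L _ _ _ ξ hξ σ' hσ' J' hJ' x hx
    have hsub := (Nat.card_eq_one_iff_unique.mp hcard).1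
    have hminus : ∀ z : ClassGroup (𝓞 K), J z = z⁻¹ → z = 1 := by
      intro z hz
      have := hsub.elim ⟨z, hz⟩ ⟨1, by simp⟩
      exact congrArg Subtype.val this
    have : NeZero (d : ℕ) := ⟨d.ne_zero⟩
    have hJm : ∀ I : (Ideal (𝓞 K))⁰, J (ClassGroup.mk0 I) = ClassGroup.mk0 (mapNZ σ I) :=
      fun I => hJ I _ rfl
    have hσσ : ∀ y, σ (σ y) = y := by
      have h1 : (σ : 𝓞 K →+* 𝓞 K).comp (σ : 𝓞 K →+* 𝓞 K) = RingHom.id _ := by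
        apply hom_ext_zeta hζ
        simp only [RingHom.comp_apply, RingHom.coe_coe, RingHom.id_apply]
        have hu : IsUnit (σ ζ) := (hζ.isUnit (NeZero.ne (m : ℕ))).map σ
        apply hu.mul_right_cancel
        rw [← map_mul, hσ, map_one, mul_comm, hσ]
      intro y
      exact DFunLike.congr_fun h1 y
    have hJJ : ∀ y, J (J y) = y := by
      intro y
      obtain ⟨I, rfl⟩ := ClassGroup.mk0_surjective y
      rw [hJm, hJ (mapNZ σ I) I]
      ext z
      change z ∈ Ideal.map σ (Ideal.map σ (I : Ideal (𝓞 K))) ↔ _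
      rw [mem_map_equiv_symm, mem_map_equiv_symm]
      have : σ.symm (σ.symm z) = z := by
        apply σ.injective
        apply σ.injective
        rw [RingEquiv.apply_symm_apply, RingEquiv.apply_symm_apply, hσσ]
      rw [this]
    have hfix : ∀ y, J y = y := by
      intro y
      have h1 := hminus (y * (J y)⁻¹) (by rw [map_mul, map_inv, hJJ]; simp [mul_comm])
      exact (mul_inv_eq_one.mp h1).symm
    have hodd : Odd (Nat.card (ClassGroup (𝓞 K))) := by
      by_contra hne
      rw [Nat.not_odd_iff_even, even_iff_two_dvd] at hne
      have : Fact (Nat.Prime 2) := ⟨Nat.prime_two⟩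
      obtain ⟨y, hy⟩ := exists_prime_orderOf_dvd_card' 2 hne
      have h1 : y * y = 1 := by rw [← sq, ← hy]; exact pow_orderOf_eq_one y
      have h2 := hminus y (by rw [hfix]; exact eq_inv_of_mul_eq_one_left h1)
      rw [h2, orderOf_one] at hy
      omega
    rcases Nat.lt_or_ge 2 (d : ℕ) with hd2 | hd2
    · obtain ⟨c, hc⟩ := PNat.dvd_iff.mp hdm
      have hmnd : (m : ℕ) = c * d := by rw [hc, mul_comm]
      have hc0 : NeZero c := ⟨by rintro rfl; simp at hmnd⟩
      have hsq' : Squarefree (c * (d : ℕ)) := hmnd ▸ hsq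
      have hnd : c.Coprime d := Nat.coprime_of_squarefree_mul hsq'
      have hcs : Squarefree c := hsq'.of_mul_left
      have hη : IsPrimitiveRoot (algebraMap (𝓞 K) K (ζ ^ c)) (d : ℕ) :=
        (hζ.pow m.pos hmnd).map_of_injective (FaithfulSMul.algebraMap_injective (𝓞 K) K)
      have hξ' : IsPrimitiveRoot (algebraMap (𝓞 L) L ξ) (d : ℕ) :=
        hξ.map_of_injective (FaithfulSMul.algebraMap_injective (𝓞 L) L)
      obtain ⟨f, hf⟩ := exists_emb hξ' hη
      let _ : Algebra L K := f.toAlgebra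
      refine core hd2 hξ hmnd hcs hnd hζ ?_ σ hσ σ' hσ' ?_
        (fun y => pow_card_eq_one') hodd J' hJ' x hx
      · apply FaithfulSMul.algebraMap_injective (𝓞 K) K
        rw [← hf]
        rfl
      · intro I I' h
        rw [← hJ I I' h, hfix]
    · have hd3 : (d : ℕ) = 2 := le_antisymm hd2 hd
      have : IsCyclotomicExtension {2} ℚ L := hd3 ▸ inferInstance
      exact triv_two ξ (hd3 ▸ hξ) x
end
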